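/- Kernel-form product formula for two Gegenbauer functions of the first kind in the hyperbolic context. Let λ, α ∈ ℂ with Re(λ+2α) > 0 and such that λ+α+1/2 is not a nonpositive integer, and let z₁, z₂ be real numbers with z₁ > 1 and z₂ > 1. For z₃ ∈ (1, (z₁z₂+1)/(z₁+z₂)) set C := (1 − z₁²z₂² − z₁²z₃² − z₂²z₃² + 2 z₁²z₂²z₃²)/(2 z₁ z₂ z₃ √((z₁²−1)(z₂²−1)(z₃²−1))) (note C > 1 on this range). Assume that the function z₃ ↦ C_λ^α(z₃) · (z₃²−1)^{α/2−5/4} · z₃^{−(λ+α+1/2)} · (C−1)^{−λ−α−1/2} is absolutely integrable on (1, (z₁z₂+1)/(z₁+z₂)). Then C_λ^α(z₁) · C_λ^α(z₂) = [cos(π(λ+α)) Γ(λ+α+1/2)] / [2^{α−1/2} √π Γ(λ+1) Γ(α) (z₁z₂)^{λ+α+1/2} (z₁²−1)^{α/2−1/4} (z₂²−1)^{α/2−1/4}] × ∫_1^{(z₁z₂+1)/(z₁+z₂)} C_λ^α(z₃) · (z₃²−1)^{α/2−5/4} · z₃^{−(λ+α+1/2)} · (C−1)^{−λ−α−1/2}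 dz₃. -/

import Mathlib

open MeasureTheory Set

/-- The regularized Gauss hypergeometric function `₂F̃₁(a,b;c;z)`. -/
noncomputable def hyp2F1reg (a b c z : ℂ) : ℂ :=
  ∑' n : ℕ, (ascPochhammer ℂ n).eval a * (ascPochhammer ℂ n).eval b /
      (Complex.Gamma (c + n) * (n.factorial : ℂ)) * z ^ n

/-- The Jacobi function of the second kind `Q_γ^{(α,β)}(z)` for real `z > 1`. -/
noncomputable def jacobiQ (α β γ : ℂ) (z : ℝ) : ℂ :=
  (2 : ℂ) ^ (α + β + γ) * Complex.Gamma (α + γ + 1) * Complex.Gamma (β + γ + 1) *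
    ((z : ℂ) - 1) ^ (-α) * ((z : ℂ) + 1) ^ (-β - γ - 1) *
    hyp2F1reg (γ + 1) (β + γ + 1) (α + β + 2 * γ + 2) (2 / (1 + (z : ℂ)))

/-- The Jacobi function of the first kind `P_γ^{(α,β)}(z)` for real `z > 1`. -/
noncomputable def jacobiP (α β γ : ℂ) (z : ℝ) : ℂ :=
  Complex.Gamma (α + γ + 1) / Complex.Gamma (γ + 1) * (((z : ℂ) + 1) / 2) ^ γ *
    hyp2F1reg (-γ) (-β - γ) (α + 1) (((z : ℂ) - 1) / ((z : ℂ) + 1))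

/-- The Jacobi function of the first kind on the cut `𝖯_γ^{(α,β)}(x)`, `x ∈ (−1,1)`. -/
noncomputable def jacobiPcut (α β γ : ℂ) (x : ℝ) : ℂ :=
  Complex.Gamma (α + γ + 1) / Complex.Gamma (γ + 1) *
    hyp2F1reg (-γ) (α + β + γ + 1) (α + 1) ((1 - (x : ℂ)) / 2)

/-- The Gegenbauer function of the first kind `C_λ^α(z)` for real `z > 1`. -/
noncomputable def gegenbauerC (lam α : ℂ) (z : ℝ) : ℂ :=
  (Real.sqrt Real.pi : ℂ) * Complex.Gamma (lam + 2 * α) /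
      ((2 : ℂ) ^ (2 * α - 1) * Complex.Gamma α * Complex.Gamma (lam + 1)) *
    (((z : ℂ) + 1) / 2) ^ lam *
    hyp2F1reg (-lam) (1 / 2 - α - lam) (α + 1 / 2) (((z : ℂ) - 1) / ((z : ℂ) + 1))

/-- The Gegenbauer function of the first kind on the cut `𝖢_λ^α(x)`, `x ∈ (−1,1)`. -/
noncomputable def gegenbauerCcut (lam α : ℂ) (x : ℝ) : ℂ :=
  (Real.sqrt Real.pi : ℂ) * Complex.Gamma (lam + 2 * α) /
      ((2 : ℂ) ^ (2 * α - 1) * Complex.Gamma α * Complex.Gamma (lam + 1)) *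
    hyp2F1reg (-lam) (lam + 2 * α) (α + 1 / 2) ((1 - (x : ℂ)) / 2)

/-- The Gegenbauer function of the second kind `D_λ^α(z)` for real `z > 1`. -/
noncomputable def gegenbauerD (lam α : ℂ) (z : ℝ) : ℂ :=
  Complex.exp ((Real.pi : ℂ) * Complex.I * α) * (Complex.Gamma (lam + 2 * α) / Complex.Gamma α) *
    (2 * (z : ℂ)) ^ (-lam - 2 * α) *
    hyp2F1reg (lam / 2 + α) (lam / 2 + α + 1 / 2) (lam + α + 1) (1 / (z : ℂ) ^ 2)

/-- The associated Legendre function of the second kind `Q_ν^μ(z)` for real `z > 1`. -/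
noncomputable def legendreQ (ν μ : ℂ) (z : ℝ) : ℂ :=
  (Real.sqrt Real.pi : ℂ) * Complex.exp ((Real.pi : ℂ) * Complex.I * μ) *
    Complex.Gamma (ν + μ + 1) * ((z : ℂ) ^ 2 - 1) ^ (μ / 2) * (2 : ℂ) ^ (-ν - 1) *
    (z : ℂ) ^ (-ν - μ - 1) *
    hyp2F1reg ((ν + μ + 1) / 2) ((ν + μ + 2) / 2) (ν + 3 / 2) (1 / (z : ℂ) ^ 2)

/-- The Legendre function of the first kind `P_ν(z)` for real `z ≥ 1`. -/
noncomputable def legendreP (ν : ℂ) (z : ℝ) : ℂ :=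
  (((z : ℂ) + 1) / 2) ^ ν * hyp2F1reg (-ν) (-ν) 1 (((z : ℂ) - 1) / ((z : ℂ) + 1))

/-- The associated Legendre function of the first kind of order `−μ`, `P_ν^{−μ}(z)`, `z > 1`. -/
noncomputable def legendrePa (ν μ : ℂ) (z : ℝ) : ℂ :=
  (((z : ℂ) - 1) / ((z : ℂ) + 1)) ^ (μ / 2) * (((z : ℂ) + 1) / 2) ^ ν *
    hyp2F1reg (-ν) (μ - ν) (μ + 1) (((z : ℂ) - 1) / ((z : ℂ) + 1))

/-- The Ferrers function of the first kind of order `−μ`, `𝖯_ν^{−μ}(x)`, `x ∈ (−1,1)`. -/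
noncomputable def ferrersP (ν μ : ℂ) (x : ℝ) : ℂ :=
  ((1 - (x : ℂ)) / (1 + (x : ℂ))) ^ (μ / 2) * hyp2F1reg (-ν) (ν + 1) (1 + μ) ((1 - (x : ℂ)) / 2)

/-- The Ferrers function of the second kind of order `−μ`, `𝖰_ν^{−μ}(x)`, `x ∈ (−1,1)`. -/
noncomputable def ferrersQ (ν μ : ℂ) (x : ℝ) : ℂ :=
  -((Real.pi : ℂ) / (2 * Complex.sin ((Real.pi : ℂ) * μ))) *
    (Complex.cos ((Real.pi : ℂ) * (ν - μ)) *
        (Complex.Gamma (ν - μ + 1) / Complex.Gamma (ν + μ + 1)) *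
        ((1 + (x : ℂ)) / (1 - (x : ℂ))) ^ (-μ / 2) *
        hyp2F1reg (-ν) (ν + 1) (1 - μ) ((1 + (x : ℂ)) / 2) -
      Complex.cos ((Real.pi : ℂ) * ν) * ((1 - (x : ℂ)) / (1 + (x : ℂ))) ^ (-μ / 2) *
        hyp2F1reg (-ν) (ν + 1) (1 + μ) ((1 + (x : ℂ)) / 2))



noncomputable def hcf (σ p : ℂ) (n : ℕ) : ℂ :=
  (ascPochhammer ℂ n).eval (2 * p - σ) * (ascPochhammer ℂ n).eval p /
    (Complex.Gamma (1 - σ + p + n) * (n.factorial : ℂ))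

noncomputable def tmm (σ p : ℂ) (k n : ℕ) (c : ℝ) : ℂ :=
  hcf σ p n * (σ - 2 * p - 2 * n) ^ k * Complex.exp ((σ - 2 * p - 2 * n) * c)

noncomputable def uu (σ p : ℂ) (k : ℕ) (c : ℝ) : ℂ := ∑' n, tmm σ p k n c

lemma hcf_succ (σ p : ℂ) (n : ℕ) :
    hcf σ p (n + 1) * ((n + 1) * (1 - σ + p + n)) = hcf σ p n * ((2 * p - σ + n) * (p + n)) := by
  unfold hcf
  have h := Complex.one_div_Gamma_eq_self_mul_one_div_Gamma_add_one (1 - σ + p + n)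
  rw [ascPochhammer_succ_eval, ascPochhammer_succ_eval, Nat.factorial_succ]
  have e : (1 - σ + p + ((n + 1 : ℕ) : ℂ)) = 1 - σ + p + n + 1 := by push_cast; ring
  rw [e]
  have hf : (n.factorial : ℂ) ≠ 0 := by exact_mod_cast n.factorial_ne_zero
  have hn : (n + 1 : ℂ) ≠ 0 := by exact_mod_cast n.succ_ne_zero
  push_cast
  simp only [div_eq_mul_inv, mul_inv] at h ⊢
  rw [h]
  field_simp

lemma hcf_differentiable (s r : ℂ → ℂ) (hs : Differentiable ℂ s) (hr : Differentiable ℂ r) (n : ℕ) :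
    Differentiable ℂ (fun z => hcf (s z) (r z) n) := by
  unfold hcf
  have h1 : ∀ q : Polynomial ℂ, Differentiable ℂ (fun z => q.eval z) := fun q => q.differentiable
  have h2 := Complex.differentiable_one_div_Gamma
  have e : (fun z => (ascPochhammer ℂ n).eval (2 * r z - s z) * (ascPochhammer ℂ n).eval (r z) /
    (Complex.Gamma (1 - s z + r z + n) * (n.factorial : ℂ))) = fun z =>
    (ascPochhammer ℂ n).eval (2 * r z - s z) * (ascPochhammer ℂ n).eval (r z) *
    (Complex.Gamma (1 - s z + r z + n))⁻¹ * ((n.factorial : ℂ))⁻¹ := by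
    ext z; rw [div_eq_mul_inv, mul_inv]; ring
  rw [e]
  refine Differentiable.mul_const (Differentiable.mul (Differentiable.mul ?_ ?_) ?_) _
  · exact (h1 _).comp ((hr.const_mul 2).sub hs)
  · exact (h1 _).comp hr
  · exact h2.comp ((((differentiable_const 1).sub hs).add hr).add_const _)

lemma hcf_continuous (n : ℕ) : Continuous (fun z : ℂ × ℂ => hcf z.1 z.2 n) := by
  unfold hcf
  have h2 := Complex.differentiable_one_div_Gamma.continuous
  have e : (fun z : ℂ × ℂ => (ascPochhammer ℂ n).eval (2 * z.2 - z.1) * (ascPochhammer ℂ n).eval (z.2) /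
    (Complex.Gamma (1 - z.1 + z.2 + n) * (n.factorial : ℂ))) = fun z =>
    (ascPochhammer ℂ n).eval (2 * z.2 - z.1) * (ascPochhammer ℂ n).eval (z.2) *
    (Complex.Gamma (1 - z.1 + z.2 + n))⁻¹ * ((n.factorial : ℂ))⁻¹ := by
    ext z; rw [div_eq_mul_inv, mul_inv]; ring
  rw [e]
  refine ((Continuous.mul ?_ ?_).mul ?_).mul continuous_const
  · exact (Polynomial.continuous _).comp (by fun_prop)
  · exact (Polynomial.continuous _).comp (by fun_prop)
  · exact h2.comp (by fun_prop : Continuous fun z : ℂ × ℂ => 1 - z.1 + z.2 + (n : ℂ))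

lemma hcf_bound (B R : ℝ) (hB : 0 ≤ B) (hR : 1 < R) : ∃ M : ℝ, 0 < M ∧ ∀ σ p : ℂ, ‖σ‖ ≤ B → ‖p‖ ≤ B →
    ∀ n, ‖hcf σ p n‖ ≤ M * R ^ n := by
  set ρ := Real.sqrt R with hρ
  have hρ1 : 1 < ρ := by rw [hρ]; exact Real.lt_sqrt_of_sq_lt (by linarith)
  have hρ2 : ρ * ρ = R := Real.mul_self_sqrt (by linarith)
  obtain ⟨N, hN⟩ := exists_nat_ge ((3 * B + 2 * ρ * B) / (ρ - 1))
  have hK : ∀ n, ∃ m, ∀ σ p : ℂ, ‖σ‖ ≤ B → ‖p‖ ≤ B → ‖hcf σ p n‖ ≤ m := by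
    intro n
    obtain ⟨m, hm⟩ := ((isCompact_closedBall (0:ℂ) B).prod
      (isCompact_closedBall (0:ℂ) B)).exists_bound_of_continuousOn (hcf_continuous n).continuousOn
    exact ⟨m, fun σ p h1 h2 => hm (σ, p) (by simp [h1, h2])⟩
  choose m hm using hK
  refine ⟨1 + ∑ i ∈ Finset.range (N + 1), |m i|, by positivity, fun σ p h1 h2 n => ?_⟩
  set M := 1 + ∑ i ∈ Finset.range (N + 1), |m i| with hM
  have hM0 : 0 < M := by positivity
  rcases le_total n N with h | h
  · have : |m n| ≤ ∑ i ∈ Finset.range (N + 1), |m i| :=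
      Finset.single_le_sum (f := fun i => |m i|) (fun i _ => abs_nonneg _) (by simp; omega)
    have h3 : ‖hcf σ p n‖ ≤ M := by
      have := hm n σ p h1 h2
      have := le_abs_self (m n)
      linarith
    have : 1 ≤ R ^ n := one_le_pow₀ hR.le
    nlinarith
  · induction n, h using Nat.le_induction with
    | base =>
      have : |m N| ≤ ∑ i ∈ Finset.range (N + 1), |m i| :=
        Finset.single_le_sum (f := fun i => |m i|) (fun i _ => abs_nonneg _) (by simp)
      have h3 : ‖hcf σ p N‖ ≤ M := by
        have := hm N σ p h1 h2
        have := le_abs_self (m N)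
        linarith
      have : 1 ≤ R ^ N := one_le_pow₀ hR.le
      nlinarith
    | succ n hn ih =>
      have hnN : (N : ℝ) ≤ n := by exact_mod_cast hn
      have h3 : 3 * B + 2 * ρ * B ≤ n * (ρ - 1) := by
        rw [div_le_iff₀ (by linarith)] at hN
        nlinarith
      have h4 : n + 3 * B ≤ ρ * (n - 2 * B) := by nlinarith
      have hn0 : (0:ℝ) ≤ n := by positivity
      have h5 : (0:ℝ) ≤ n - 2 * B := by
        by_contra h
        push Not at h
        nlinarith
      have e := congrArg norm (hcf_succ σ p n)
      rw [norm_mul, norm_mul, norm_mul, norm_mul] at e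
      have nn : ‖(n:ℂ)‖ = n := by simp
      have a1 : ‖(n + 1 : ℂ)‖ = n + 1 := by
        have : ((n + 1 : ℝ) : ℂ) = n + 1 := by push_cast; rfl
        rw [← this, Complex.norm_real, Real.norm_of_nonneg (by positivity)]
      have a2 : (n : ℝ) + 1 - 2 * B ≤ ‖1 - σ + p + (n:ℂ)‖ := by
        have := norm_sub_norm_le ((n + 1 : ℂ)) (σ - p)
        have h6 := norm_sub_le σ p
        have e : (n + 1 : ℂ) - (σ - p) = 1 - σ + p + n := by ring
        rw [e] at this
        linarith
      have a3 : ‖2 * p - σ + n‖ ≤ n + 3 * B := by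
        have := norm_add_le (2 * p - σ) n
        have h6 := norm_sub_le (2 * p) σ
        rw [norm_mul] at h6
        simp at h6 this
        linarith
      have a4 : ‖p + n‖ ≤ n + B := by
        have := norm_add_le p n
        simp at this; linarith
      rw [a1] at e
      have h7 : ‖2 * p - σ + n‖ * ‖p + n‖ ≤ R * ((n + 1) * ‖1 - σ + p + (n:ℂ)‖) := by
        calc ‖2 * p - σ + n‖ * ‖p + n‖ ≤ (n + 3 * B) * (n + B) := by gcongr
          _ ≤ (ρ * (n - 2 * B)) * (ρ * n) := by
            gcongr
            nlinarith
          _ = R * (n * (n - 2 * B)) := by rw [← hρ2]; ring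
          _ ≤ _ := by gcongr <;> linarith
      have pos : 0 < (n + 1) * ‖1 - σ + p + (n:ℂ)‖ := by
        apply mul_pos; positivity; linarith
      have h8 : ‖hcf σ p (n+1)‖ * ((n + 1) * ‖1 - σ + p + (n:ℂ)‖) ≤
          (M * R ^ (n+1)) * ((n + 1) * ‖1 - σ + p + (n:ℂ)‖) := by
        rw [e]
        calc _ ≤ (M * R ^ n) * (R * ((n + 1) * ‖1 - σ + p + (n:ℂ)‖)) := by gcongr
          _ = _ := by ring
      exact le_of_mul_le_mul_right h8 pos

lemma tmm_bound (B c₀ : ℝ) (hB : 0 ≤ B) (hc₀ : 0 < c₀) (k : ℕ) : ∃ b : ℕ → ℝ, Summable b ∧ (∀ n, 0 ≤ b n) ∧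
    ∀ σ p : ℂ, ‖σ‖ ≤ B → ‖p‖ ≤ B → ∀ c, c₀ ≤ c → ∀ n,
      ‖tmm σ p k n c‖ ≤ b n * Real.exp ((σ - 2 * p).re * c) := by
  obtain ⟨M, hM, h⟩ := hcf_bound B (Real.exp c₀) hB (by simpa using hc₀)
  have hr : Real.exp (-c₀) < 1 := by simpa using hc₀
  refine ⟨fun n => M * (3 * B + 2) ^ k * ((n + 1 : ℕ) ^ k * Real.exp (-c₀) ^ n), ?_, fun n => by positivity, ?_⟩
  · apply Summable.mul_left
    have h1 := summable_pow_mul_geometric_of_norm_lt_one (R := ℝ) k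
      (r := Real.exp (-c₀)) (by rwa [Real.norm_of_nonneg (Real.exp_pos _).le])
    have h2 := ((summable_nat_add_iff 1).2 h1).mul_right (Real.exp (-c₀))⁻¹
    refine h2.congr (fun n => ?_)
    rw [pow_succ]
    field_simp
  · intro σ p h1 h2 c hc n
    unfold tmm
    rw [norm_mul, norm_mul, norm_pow, Complex.norm_exp]
    have a0 : ((σ - 2 * p - 2 * n) * (c:ℂ)).re = (σ - 2 * p).re * c + n * (-2 * c) := by
      simp; ring
    have a1 : ‖σ - 2 * p - 2 * n‖ ≤ (3 * B + 2) * (n + 1 : ℕ) := by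
      have b1 := norm_sub_le (σ - 2 * p) (2 * n)
      have b2 := norm_sub_le σ (2 * p)
      rw [norm_mul] at b1 b2
      simp at b1 b2
      push_cast
      have : (0:ℝ) ≤ n := by positivity
      nlinarith
    rw [a0, Real.exp_add, Real.exp_nat_mul]
    have a2 : Real.exp c₀ ^ n * Real.exp (-2 * c) ^ n ≤ Real.exp (-c₀) ^ n := by
      rw [← mul_pow, ← Real.exp_add]
      gcongr
      linarith
    calc _ ≤ (M * Real.exp c₀ ^ n) * ((3 * B + 2) * (n + 1 : ℕ)) ^ k *
          (Real.exp ((σ - 2 * p).re * c) * Real.exp (-2 * c) ^ n) := by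
          gcongr
          exact h σ p h1 h2 n
      _ = M * (3 * B + 2) ^ k * ((n + 1 : ℕ) ^ k * (Real.exp c₀ ^ n * Real.exp (-2 * c) ^ n)) *
          Real.exp ((σ - 2 * p).re * c) := by rw [mul_pow]; ring
      _ ≤ _ := by beta_reduce; gcongr

lemma tmm_summable (σ p : ℂ) (k : ℕ) (c : ℝ) (hc : 0 < c) : Summable (fun n => tmm σ p k n c) := by
  obtain ⟨b, hb, -, h⟩ := tmm_bound (max ‖σ‖ ‖p‖) c (by positivity) hc k
  exact Summable.of_norm_bounded (hb.mul_right _)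
    (h σ p (le_max_left _ _) (le_max_right _ _) c le_rfl)

lemma uu_bound (B c₀ : ℝ) (hB : 0 ≤ B) (hc₀ : 0 < c₀) (k : ℕ) : ∃ K : ℝ, 0 < K ∧
    ∀ σ p : ℂ, ‖σ‖ ≤ B → ‖p‖ ≤ B → ∀ c, c₀ ≤ c →
      ‖uu σ p k c‖ ≤ K * Real.exp ((σ - 2 * p).re * c) := by
  obtain ⟨b, hb, hb0, h⟩ := tmm_bound B c₀ hB hc₀ k
  refine ⟨1 + ∑' n, b n, ?_, fun σ p h1 h2 c hc => ?_⟩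
  · have : 0 ≤ ∑' n, b n := tsum_nonneg hb0
    positivity
  have h3 : ‖uu σ p k c‖ ≤ ∑' n, b n * Real.exp ((σ - 2 * p).re * c) :=
    tsum_of_norm_bounded (hb.mul_right _).hasSum (h σ p h1 h2 c hc)
  rw [tsum_mul_right] at h3
  have := Real.exp_pos ((σ - 2 * p).re * c)
  nlinarith

lemma uu_hasDerivAt (σ p : ℂ) (k : ℕ) (c : ℝ) (hc : 0 < c) :
    HasDerivAt (uu σ p k) (uu σ p (k + 1) c) c := by
  obtain ⟨b, hb, hb0, h⟩ := tmm_bound (max ‖σ‖ ‖p‖) (c / 2) (by positivity) (by positivity) (k + 1)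
  refine hasDerivAt_tsum_of_isPreconnected (t := Ioo (c / 2) (2 * c)) (y₀ := c)
    (hb.mul_right (Real.exp (|(σ - 2 * p).re| * (2 * c)))) isOpen_Ioo isPreconnected_Ioo ?_ ?_ ?_ ?_ ?_
  · intro n y hy
    unfold tmm
    have h1 : HasDerivAt (fun y : ℝ => Complex.exp ((σ - 2 * p - 2 * n) * y))
      (Complex.exp ((σ - 2 * p - 2 * n) * y) * ((σ - 2 * p - 2 * n) * 1)) y := by
      apply HasDerivAt.cexp
      exact (HasDerivAt.ofReal_comp (hasDerivAt_id y)).const_mul _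
    refine (h1.const_mul (hcf σ p n * (σ - 2 * p - 2 * n) ^ k)).congr_deriv ?_
    rw [pow_succ]; ring
  · intro n y hy
    refine (h σ p (le_max_left _ _) (le_max_right _ _) y hy.1.le n).trans ?_
    have := hb0 n
    gcongr
    · have := hy.1; linarith
    · exact le_abs_self _
    · exact hy.2.le
  · constructor <;> linarith
  · exact tmm_summable σ p k c hc
  · constructor <;> linarith

lemma uu_ode (σ p : ℂ) (c : ℝ) (hc : 0 < c) :
    (Real.sinh c : ℂ) * uu σ p 2 c + 2 * p * Real.cosh c * uu σ p 1 c =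
      (σ - 2 * p) * σ * Real.sinh c * uu σ p 0 c := by
  have key : (uu σ p 2 c + 2 * p * uu σ p 1 c - (σ - 2 * p) * σ * uu σ p 0 c) =
      Complex.exp (-2 * c) * (uu σ p 2 c - 2 * p * uu σ p 1 c - (σ - 2 * p) * σ * uu σ p 0 c) := by
    have s0 := tmm_summable σ p 0 c hc
    have s1 := tmm_summable σ p 1 c hc
    have s2 := tmm_summable σ p 2 c hc
    have L : HasSum (fun n => tmm σ p 2 n c + 2 * p * tmm σ p 1 n c - (σ - 2 * p) * σ * tmm σ p 0 n c)
      (uu σ p 2 c + 2 * p * uu σ p 1 c - (σ - 2 * p) * σ * uu σ p 0 c) :=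
      (s2.hasSum.add (s1.hasSum.mul_left _)).sub (s0.hasSum.mul_left _)
    have Rr : HasSum (fun n => Complex.exp (-2 * c) * (tmm σ p 2 n c - 2 * p * tmm σ p 1 n c - (σ - 2 * p) * σ * tmm σ p 0 n c))
      (Complex.exp (-2 * c) * (uu σ p 2 c - 2 * p * uu σ p 1 c - (σ - 2 * p) * σ * uu σ p 0 c)) :=
      ((s2.hasSum.sub (s1.hasSum.mul_left _)).sub (s0.hasSum.mul_left _)).mul_left _
    rw [← hasSum_nat_add_iff' 1] at L
    have z : tmm σ p 2 0 c + 2 * p * tmm σ p 1 0 c - (σ - 2 * p) * σ * tmm σ p 0 0 c = 0 := by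
      unfold tmm; push_cast; ring
    simp only [Finset.sum_range_one, z, sub_zero] at L
    refine L.unique (Rr.congr_fun ?_)
    intro n
    unfold tmm
    have e := hcf_succ σ p n
    have ex : Complex.exp ((σ - 2 * p - 2 * ((n + 1 : ℕ) : ℂ)) * c) =
      Complex.exp (-2 * c) * Complex.exp ((σ - 2 * p - 2 * n) * c) := by
      rw [← Complex.exp_add]; congr 1; push_cast; ring
    rw [ex]
    push_cast
    linear_combination (4 * Complex.exp (-2 * c) * Complex.exp ((σ - 2 * p - 2 * n) * c)) * e
  have hs : (Real.sinh c : ℂ) = Complex.exp c * (1 - Complex.exp (-2 * c)) / 2 := by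
    rw [Complex.ofReal_sinh, Complex.sinh, mul_sub, ← Complex.exp_add]; ring_nf
  have hch : (Real.cosh c : ℂ) = Complex.exp c * (1 + Complex.exp (-2 * c)) / 2 := by
    rw [Complex.ofReal_cosh, Complex.cosh, mul_add, ← Complex.exp_add]; ring_nf
  rw [hs, hch]
  linear_combination (Complex.exp c / 2) * key

lemma uu_differentiable (s r : ℂ → ℂ) (hs : Differentiable ℂ s) (hr : Differentiable ℂ r) (k : ℕ)
    (c : ℝ) (hc : 0 < c) : Differentiable ℂ (fun z => uu (s z) (r z) k c) := by
  intro z₀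
  obtain ⟨B1, hB1⟩ := (isCompact_closedBall z₀ 1).exists_bound_of_continuousOn hs.continuous.continuousOn
  obtain ⟨B2, hB2⟩ := (isCompact_closedBall z₀ 1).exists_bound_of_continuousOn hr.continuous.continuousOn
  obtain ⟨B3, hB3⟩ := (isCompact_closedBall z₀ 1).exists_bound_of_continuousOn
    (f := fun z => (((s z - 2 * r z).re * c : ℝ))) (by
      apply Continuous.continuousOn
      have := hs.continuous
      have := hr.continuous
      fun_prop)
  have hB1' : 0 ≤ B1 := (norm_nonneg _).trans (hB1 z₀ (by simp))
  obtain ⟨b, hb, hb0, h⟩ := tmm_bound (max B1 B2) c (by positivity) hc k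
  have : DifferentiableOn ℂ (fun z => ∑' n, tmm (s z) (r z) k n c) (Metric.ball z₀ 1) := by
    refine Complex.differentiableOn_tsum_of_summable_norm (hb.mul_right (Real.exp B3)) ?_ Metric.isOpen_ball ?_
    · intro n
      unfold tmm
      have := hcf_differentiable s r hs hr n
      apply Differentiable.differentiableOn
      fun_prop
    · intro n z hz
      have hz' := Metric.ball_subset_closedBall hz
      refine (h (s z) (r z) ((hB1 z hz').trans (le_max_left _ _)) ((hB2 z hz').trans (le_max_right _ _))
        c le_rfl n).trans ?_
      have := hb0 n
      gcongr
      exact (le_abs_self _).trans (hB3 z hz')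
  exact this.differentiableAt (Metric.ball_mem_nhds _ one_pos)

lemma uu_tendsto (σ p : ℂ) :
    Filter.Tendsto (fun c : ℝ => uu σ p 0 c * Complex.exp (-((σ - 2 * p) * c))) Filter.atTop
      (nhds (hcf σ p 0)) := by
  obtain ⟨b, hb, hb0, h⟩ := tmm_bound (max ‖σ‖ ‖p‖) 1 (by positivity) one_pos 0
  have e : hcf σ p 0 = ∑' n : ℕ, (if n = 0 then hcf σ p 0 else 0) := by simp
  rw [e]
  have e2 : ∀ c : ℝ, uu σ p 0 c * Complex.exp (-((σ - 2 * p) * c)) =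
    ∑' n, tmm σ p 0 n c * Complex.exp (-((σ - 2 * p) * c)) := fun c => by
      rw [tsum_mul_right]; rfl
  simp_rw [e2]
  refine tendsto_tsum_of_dominated_convergence hb ?_ ?_
  · intro n
    have e3 : ∀ c : ℝ, tmm σ p 0 n c * Complex.exp (-((σ - 2 * p) * c)) =
        hcf σ p n * ((Real.exp (-(2 * n * c)) : ℝ) : ℂ) := by
      intro c
      unfold tmm
      rw [pow_zero, mul_one, mul_assoc, ← Complex.exp_add]
      congr 1
      push_cast
      congr 1; ring
    simp_rw [e3]
    rcases Nat.eq_zero_or_pos n with rfl | hn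
    · simp
    · rw [if_neg hn.ne']
      have : Filter.Tendsto (fun c : ℝ => Real.exp (-(2 * n * c))) Filter.atTop (nhds 0) := by
        apply Real.tendsto_exp_neg_atTop_nhds_zero.comp
        apply Filter.Tendsto.const_mul_atTop (by positivity) Filter.tendsto_id
      have := (((Complex.continuous_ofReal.tendsto _).comp this).const_mul (hcf σ p n))
      simpa using this
  · filter_upwards [Filter.eventually_ge_atTop (1:ℝ)] with c hc n
    have h1 := h σ p (le_max_left _ _) (le_max_right _ _) c hc n
    rw [norm_mul, Complex.norm_exp]
    have : (-((σ - 2 * p) * (c:ℂ))).re = - ((σ - 2 * p).re * c) := by simp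
    rw [this]
    calc _ ≤ b n * Real.exp ((σ - 2 * p).re * c) * Real.exp (-((σ - 2 * p).re * c)) := by gcongr
      _ = b n := by rw [mul_assoc, ← Real.exp_add]; simp

lemma uu_ne_zero (σ p : ℝ) (hσ : σ < 1) (hp : 0 < p) (hσp : σ < 2 * p) (c : ℝ) (hc : 0 < c) :
    uu σ p 0 c ≠ 0 := by
  set f : ℕ → ℝ := fun n => (ascPochhammer ℝ n).eval (2 * p - σ) * (ascPochhammer ℝ n).eval p /
    (Real.Gamma (1 - σ + p + n) * (n.factorial : ℝ)) * Real.exp ((σ - 2 * p - 2 * n) * c) with hf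
  have hfe : ∀ n, tmm σ p 0 n c = (f n : ℂ) := by
    intro n
    have hev : ∀ x : ℝ, (ascPochhammer ℂ n).eval (x : ℂ) = (((ascPochhammer ℝ n).eval x : ℝ) : ℂ) := by
      intro x
      have := ascPochhammer_map (Complex.ofRealHom) n
      rw [← this]
      exact Polynomial.eval_map_apply (f := Complex.ofRealHom) x
    unfold tmm hcf
    simp only [hf]
    have h1 := hev (2 * p - σ)
    have h2 := hev p
    push_cast at h1 ⊢
    rw [h1, h2, ← Complex.Gamma_ofReal]
    push_cast
    simp
  have hpos : ∀ n, 0 < f n := by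
    intro n
    have h1 : 0 < (ascPochhammer ℝ n).eval (2 * p - σ) := ascPochhammer_pos n _ (by linarith)
    have h2 : 0 < (ascPochhammer ℝ n).eval p := ascPochhammer_pos n _ hp
    have h3 : 0 < Real.Gamma (1 - σ + p + n) := Real.Gamma_pos_of_pos (by have : (0:ℝ) ≤ n := by positivity
                                                                          linarith)
    simp only [hf]
    positivity
  have hsum : Summable f := by
    have := tmm_summable σ p 0 c hc
    simp_rw [hfe] at this
    exact_mod_cast this
  unfold uu
  simp_rw [hfe]
  rw [← Complex.ofReal_tsum]
  exact_mod_cast (hsum.tsum_pos (fun n => (hpos n).le) 0 (hpos 0)).ne'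



noncomputable def vv (σ p : ℂ) (w : ℝ) : ℂ := uu σ p 0 (Real.arcosh w)
noncomputable def v1 (σ p : ℂ) (w : ℝ) : ℂ := uu σ p 1 (Real.arcosh w) / (Real.sqrt (w ^ 2 - 1) : ℂ)
noncomputable def v2 (σ p : ℂ) (w : ℝ) : ℂ :=
  ((σ - 2 * p) * σ * vv σ p w - (2 * p + 1) * w * v1 σ p w) / ((w ^ 2 - 1 : ℝ) : ℂ)
noncomputable def om (p : ℂ) (t : ℝ) : ℂ := ((t ^ 2 - 1 : ℝ) : ℂ) ^ p
noncomputable def ww (a b t : ℝ) : ℝ := Real.cosh a * Real.cosh b + Real.sinh a * Real.sinh b * t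
noncomputable def wa (a b t : ℝ) : ℝ := Real.sinh a * Real.cosh b + Real.cosh a * Real.sinh b * t

lemma vv_hasDerivAt (σ p : ℂ) (w : ℝ) (hw : 1 < w) : HasDerivAt (vv σ p) (v1 σ p w) w := by
  have h1 := uu_hasDerivAt σ p 0 _ (Real.arcosh_pos hw)
  have h2 := Real.hasDerivAt_arcosh (x := w) hw
  refine (h1.scomp w h2).congr_deriv ?_
  simp [v1, div_eq_inv_mul]

lemma sq_sub_pos {w : ℝ} (hw : 1 < w) : 0 < w ^ 2 - 1 := by nlinarith

lemma v1_hasDerivAt (σ p : ℂ) (w : ℝ) (hw : 1 < w) : HasDerivAt (v1 σ p) (v2 σ p w) w := by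
  have h1 := uu_hasDerivAt σ p 1 _ (Real.arcosh_pos hw)
  have h2 := Real.hasDerivAt_arcosh (x := w) hw
  have h3 := h1.scomp w h2
  have hpos := sq_sub_pos hw
  have h4 : HasDerivAt (fun w : ℝ => Real.sqrt (w ^ 2 - 1)) ((2 * w) / (2 * Real.sqrt (w ^ 2 - 1))) w := by
    have : HasDerivAt (fun w : ℝ => w ^ 2 - 1) (2 * w) w := by
      simpa using (hasDerivAt_pow 2 w).sub_const 1
    exact this.sqrt hpos.ne'
  have hS : 0 < Real.sqrt (w ^ 2 - 1) := Real.sqrt_pos.2 hpos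
  have hSS : (Real.sqrt (w ^ 2 - 1) : ℂ) ≠ 0 := by exact_mod_cast hS.ne'
  have h5 := h3.div h4.ofReal_comp hSS
  refine h5.congr_deriv ?_
  have ode := uu_ode σ p _ (Real.arcosh_pos hw)
  rw [Real.sinh_arcosh hw.le, Real.cosh_arcosh hw.le] at ode
  have hsq : ((w ^ 2 - 1 : ℝ) : ℂ) = (Real.sqrt (w ^ 2 - 1) : ℂ) ^ 2 := by
    rw [← Complex.ofReal_pow, Real.sq_sqrt hpos.le]
  simp only [v2, vv, v1, hsq]
  set S := Real.sqrt (w ^ 2 - 1)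
  simp only [Complex.real_smul, Function.comp]
  push_cast
  field_simp
  linear_combination ode

lemma cont_vv (σ p : ℂ) : ContinuousOn (vv σ p) (Ioi 1) :=
  fun w hw => (vv_hasDerivAt σ p w hw).continuousAt.continuousWithinAt
lemma cont_v1 (σ p : ℂ) : ContinuousOn (v1 σ p) (Ioi 1) :=
  fun w hw => (v1_hasDerivAt σ p w hw).continuousAt.continuousWithinAt
lemma cont_v2 (σ p : ℂ) : ContinuousOn (v2 σ p) (Ioi 1) := by
  unfold v2
  refine ContinuousOn.div ?_ (by fun_prop) ?_
  · have := cont_vv σ p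
    have := cont_v1 σ p
    fun_prop
  · intro w hw
    exact_mod_cast (sq_sub_pos hw).ne'

lemma exp_arcosh_bd {w l B : ℝ} (hw : 1 < w) (hl : |l| ≤ B) :
    Real.exp (l * Real.arcosh w) ≤ 2 ^ B * w ^ l := by
  have h0 : 0 < w := by linarith
  have h1 := Real.exp_arcosh hw.le
  have h2 : Real.sqrt (w ^ 2 - 1) ≤ w := Real.sqrt_le_iff.2 ⟨h0.le, by linarith⟩
  have h3 := Real.sqrt_nonneg (w ^ 2 - 1)
  rw [mul_comm, Real.exp_mul, h1]
  have e : w + Real.sqrt (w ^ 2 - 1) = ((w + Real.sqrt (w ^ 2 - 1)) / w) * w := by field_simp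
  rw [e, Real.mul_rpow (by positivity) h0.le]
  gcongr
  have h4 : 1 ≤ (w + Real.sqrt (w ^ 2 - 1)) / w := by rw [le_div_iff₀ h0]; linarith
  have h5 : (w + Real.sqrt (w ^ 2 - 1)) / w ≤ 2 := by rw [div_le_iff₀ h0]; linarith
  calc _ ≤ ((w + Real.sqrt (w ^ 2 - 1)) / w) ^ B :=
        Real.rpow_le_rpow_of_exponent_le h4 ((le_abs_self _).trans hl)
    _ ≤ 2 ^ B := by
      apply Real.rpow_le_rpow (by positivity) h5
      exact (abs_nonneg _).trans hl

lemma v_bound (B w₀ : ℝ) (hB : 0 ≤ B) (hw₀ : 1 < w₀) : ∃ K : ℝ, 0 < K ∧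
    ∀ σ p : ℂ, ‖σ‖ ≤ B → ‖p‖ ≤ B → ∀ w, w₀ ≤ w →
      ‖vv σ p w‖ ≤ K * w ^ (σ - 2 * p).re ∧ ‖v1 σ p w‖ ≤ K * w ^ ((σ - 2 * p).re - 1) ∧
      ‖v2 σ p w‖ ≤ K * w ^ ((σ - 2 * p).re - 2) := by
  obtain ⟨K0, hK0, h0⟩ := uu_bound B _ hB (Real.arcosh_pos hw₀) 0
  obtain ⟨K1, hK1, h1⟩ := uu_bound B _ hB (Real.arcosh_pos hw₀) 1
  set κ := 1 - 1 / w₀ ^ 2 with hκ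
  have hκ0 : 0 < κ := by
    rw [hκ, sub_pos, div_lt_one (by positivity)]; nlinarith
  have hsq : ∀ w, w₀ ≤ w → κ * w ^ 2 ≤ w ^ 2 - 1 := by
    intro w hw
    have : 1 ≤ w ^ 2 / w₀ ^ 2 := by rw [one_le_div (by positivity)]; gcongr
    have e : κ * w ^ 2 = w ^ 2 - w ^ 2 / w₀ ^ 2 := by rw [hκ]; ring
    linarith
  set A0 := K0 * 2 ^ (3 * B) with hA0
  set A1 := K1 * 2 ^ (3 * B) / Real.sqrt κ with hA1
  have hA0p : 0 < A0 := by positivity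
  have hA1p : 0 < A1 := by positivity
  set A2 := (3 * B * B * A0 + (2 * B + 1) * A1) / κ with hA2
  have hA2p : 0 < A2 := by positivity
  refine ⟨A0 + A1 + A2, by positivity, fun σ p hσ hp w hw => ?_⟩
  have hw1 : 1 < w := by linarith
  have hwp : 0 < w := by linarith
  have hn : ‖σ - 2 * p‖ ≤ 3 * B := by
    have b2 := norm_sub_le σ (2 * p)
    rw [norm_mul] at b2
    simp at b2; linarith
  have hl : |(σ - 2 * p).re| ≤ 3 * B := (Complex.abs_re_le_norm _).trans hn
  set l := (σ - 2 * p).re with hlv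
  have hE := exp_arcosh_bd hw1 hl
  have hac : Real.arcosh w₀ ≤ Real.arcosh w := (Real.arcosh_le_arcosh (by linarith) hwp).2 hw
  have b0 : ‖vv σ p w‖ ≤ A0 * w ^ l := by
    calc _ ≤ K0 * Real.exp (l * Real.arcosh w) := h0 σ p hσ hp _ hac
      _ ≤ K0 * (2 ^ (3 * B) * w ^ l) := by gcongr
      _ = _ := by rw [hA0]; ring
  have hS : Real.sqrt κ * w ≤ Real.sqrt (w ^ 2 - 1) := by
    apply Real.le_sqrt_of_sq_le
    rw [mul_pow, Real.sq_sqrt hκ0.le]; exact hsq w hw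
  have hsk : 0 < Real.sqrt κ := Real.sqrt_pos.2 hκ0
  have b1 : ‖v1 σ p w‖ ≤ A1 * w ^ (l - 1) := by
    unfold v1
    rw [norm_div, Complex.norm_real, Real.norm_of_nonneg (Real.sqrt_nonneg _)]
    calc _ ≤ (K1 * Real.exp (l * Real.arcosh w)) / (Real.sqrt κ * w) := by
          gcongr
          exact h1 σ p hσ hp _ hac
      _ ≤ (K1 * (2 ^ (3 * B) * w ^ l)) / (Real.sqrt κ * w) := by gcongr
      _ = _ := by rw [hA1, Real.rpow_sub_one hwp.ne']; field_simp
  have b2 : ‖v2 σ p w‖ ≤ A2 * w ^ (l - 2) := by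
    unfold v2
    have hpos := sq_sub_pos hw1
    rw [norm_div, Complex.norm_real, Real.norm_of_nonneg hpos.le]
    have hwp1 : w * w ^ (l - 1) = w ^ l := by rw [Real.rpow_sub_one hwp.ne']; field_simp
    have hwp2 : w ^ l / w ^ 2 = w ^ (l - 2) := by
      rw [Real.rpow_sub hwp]; norm_num
    have n1 : ‖(σ - 2 * p) * σ * vv σ p w - (2 * p + 1) * w * v1 σ p w‖ ≤
        3 * B * B * (A0 * w ^ l) + (2 * B + 1) * w * (A1 * w ^ (l - 1)) := by
      refine (norm_sub_le _ _).trans ?_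
      rw [norm_mul, norm_mul, norm_mul, norm_mul, Complex.norm_real, Real.norm_of_nonneg hwp.le]
      have : ‖2 * p + 1‖ ≤ 2 * B + 1 := by
        refine (norm_add_le _ _).trans ?_
        rw [norm_mul]; simp; linarith
      gcongr
    calc _ ≤ (3 * B * B * (A0 * w ^ l) + (2 * B + 1) * w * (A1 * w ^ (l - 1))) / (κ * w ^ 2) := by
          gcongr
          exact hsq w hw
      _ = A2 * (w ^ l / w ^ 2) := by
        have : (2 * B + 1) * w * (A1 * w ^ (l - 1)) = (2 * B + 1) * A1 * w ^ l := by
          rw [← hwp1]; ring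
        rw [this, hA2]; field_simp
      _ = _ := by rw [hwp2]
  refine ⟨b0.trans ?_, b1.trans ?_, b2.trans ?_⟩
  · gcongr; linarith
  · gcongr; linarith
  · gcongr; linarith

lemma om_norm (p : ℂ) (t : ℝ) (ht : 1 < t) : ‖om p t‖ = (t ^ 2 - 1) ^ p.re := by
  unfold om
  rw [Complex.norm_cpow_eq_rpow_re_of_pos (sq_sub_pos ht)]

lemma om_hasDerivAt (p : ℂ) (t : ℝ) (ht : 1 < t) :
    HasDerivAt (om p) (2 * t * p * om (p - 1) t) t := by
  have hpos := sq_sub_pos ht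
  have h1 : HasDerivAt (fun y : ℝ => (y : ℂ) ^ p) (p * ((t ^ 2 - 1 : ℝ) : ℂ) ^ (p - 1)) (t ^ 2 - 1) := by
    have h0 := ((hasDerivAt_id ((t ^ 2 - 1 : ℝ) : ℂ)).cpow_const (c := p)
      (by simp only [id]; exact Complex.ofReal_mem_slitPlane.2 hpos))
    simpa using h0.comp_ofReal
  have h2 : HasDerivAt (fun w : ℝ => w ^ 2 - 1) (2 * t) t := by
    simpa using (hasDerivAt_pow 2 t).sub_const 1
  refine (h1.scomp t h2).congr_deriv ?_
  simp [om]; ring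

lemma cont_om (p : ℂ) : ContinuousOn (om p) (Ioi 1) :=
  fun w hw => (om_hasDerivAt p w hw).continuousAt.continuousWithinAt

lemma om_succ (p : ℂ) (t : ℝ) (ht : 1 < t) : om p t = om (p - 1) t * ((t ^ 2 - 1 : ℝ) : ℂ) := by
  unfold om
  have : ((t ^ 2 - 1 : ℝ) : ℂ) ≠ 0 := by exact_mod_cast (sq_sub_pos ht).ne'
  rw [Complex.cpow_sub _ _ this, Complex.cpow_one]
  field_simp

lemma integrable_pw (e s : ℝ) (hs : -1 < s) (he : e + 2 * s < -1) :
    IntegrableOn (fun t : ℝ => t ^ e * (t ^ 2 - 1) ^ s) (Ioi 1) := by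
  have hm : ∀ A : Set ℝ, MeasurableSet A → AEStronglyMeasurable (fun t : ℝ => t ^ e * (t ^ 2 - 1) ^ s) (volume.restrict A) := by
    intro A hA
    apply Measurable.aestronglyMeasurable
    fun_prop
  rw [← Ioc_union_Ioi_eq_Ioi (show (1:ℝ) ≤ 2 by norm_num), integrableOn_union]
  constructor
  · have h1 : IntegrableOn (fun t : ℝ => (t - 1) ^ s) (Ioc 1 2) := by
      have := (intervalIntegral.intervalIntegrable_rpow' (a := 0) (b := 1) hs).comp_sub_right 1
      norm_num at this
      rwa [intervalIntegrable_iff_integrableOn_Ioc_of_le (by norm_num)] at this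
    refine Integrable.mono' (h1.const_mul (2 ^ |e| * 3 ^ |s|)) (hm _ measurableSet_Ioc) ?_
    refine (ae_restrict_iff' measurableSet_Ioc).2 (Filter.Eventually.of_forall fun t ht => ?_)
    have ht1 : 0 < t - 1 := by linarith [ht.1]
    have ht0 : 0 < t := by linarith
    have e1 : t ^ 2 - 1 = (t + 1) * (t - 1) := by ring
    rw [Real.norm_of_nonneg (by
      have := sq_sub_pos ht.1
      positivity), e1, Real.mul_rpow (by linarith) ht1.le]
    have a1 : t ^ e ≤ 2 ^ |e| := by
      calc t ^ e ≤ t ^ |e| := Real.rpow_le_rpow_of_exponent_le ht.1.le (le_abs_self _)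
        _ ≤ 2 ^ |e| := Real.rpow_le_rpow ht0.le ht.2 (abs_nonneg _)
    have a2 : (t + 1) ^ s ≤ 3 ^ |s| := by
      calc (t + 1) ^ s ≤ (t + 1) ^ |s| := Real.rpow_le_rpow_of_exponent_le (by linarith) (le_abs_self _)
        _ ≤ 3 ^ |s| := Real.rpow_le_rpow (by linarith) (by linarith [ht.2]) (abs_nonneg _)
    rw [← mul_assoc]
    gcongr
  · have h1 := (integrableOn_Ioi_rpow_of_lt he (show (0:ℝ) < 2 by norm_num)).const_mul (2 ^ |s|)
    refine Integrable.mono' h1 (hm _ measurableSet_Ioi) ?_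
    refine (ae_restrict_iff' measurableSet_Ioi).2 (Filter.Eventually.of_forall fun t ht => ?_)
    have ht : 2 < t := ht
    have ht0 : 0 < t := by linarith
    have hp := sq_sub_pos (show 1 < t by linarith)
    rw [Real.norm_of_nonneg (by positivity), Real.rpow_add ht0]
    have e1 : t ^ 2 - 1 = ((t ^ 2 - 1) / t ^ 2) * t ^ 2 := by field_simp
    have e2 : (t ^ 2) ^ s = t ^ (2 * s) := by rw [Real.rpow_mul ht0.le]; norm_num
    rw [e1, Real.mul_rpow (by positivity) (by positivity), e2]
    have a1 : ((t ^ 2 - 1) / t ^ 2) ^ s ≤ 2 ^ |s| := by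
      have b1 : (t ^ 2 - 1) / t ^ 2 ≤ 1 := by rw [div_le_one (by positivity)]; linarith
      have b2 : 1 / 2 ≤ (t ^ 2 - 1) / t ^ 2 := by
        rw [div_le_div_iff₀ (by norm_num) (by positivity)]; nlinarith
      calc _ ≤ ((t ^ 2 - 1) / t ^ 2) ^ (- |s|) :=
            Real.rpow_le_rpow_of_exponent_ge (by positivity) b1 (neg_abs_le s)
        _ ≤ (1 / 2) ^ (- |s|) :=
            Real.rpow_le_rpow_of_nonpos (by norm_num) b2 (by simp)
        _ = 2 ^ |s| := by rw [one_div, Real.inv_rpow (by norm_num), Real.rpow_neg (by norm_num), inv_inv]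
    calc _ = t ^ e * t ^ (2 * s) * ((t ^ 2 - 1) / t ^ 2) ^ s := by ring
      _ ≤ t ^ e * t ^ (2 * s) * 2 ^ |s| := by gcongr
      _ = _ := by ring

lemma ftc0 (f f' : ℝ → ℂ) (hd : ∀ t, 1 < t → HasDerivAt f (f' t) t) (hi : IntegrableOn f' (Ioi 1))
    (h1 : Filter.Tendsto f (nhdsWithin 1 (Ioi 1)) (nhds 0)) (h2 : Filter.Tendsto f Filter.atTop (nhds 0)) :
    ∫ t in Ioi (1:ℝ), f' t = 0 := by
  have h := integral_Ioi_of_hasDerivAt_of_tendsto (a := 1) (f := Function.update f 1 0) (f' := f') (m := 0) ?_ ?_ hi ?_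
  · rw [h]; simp
  · rw [continuousWithinAt_update_same]
    have : Ici (1:ℝ) \ {1} = Ioi 1 := by ext x; simp [lt_iff_le_and_ne, eq_comm]
    rwa [this]
  · intro t ht
    refine (hd t ht).congr_of_eventuallyEq ?_
    filter_upwards [Ioi_mem_nhds (show (1:ℝ) < t from ht)] with x hx
    rw [Function.update_of_ne (ne_of_gt hx)]
  · refine h2.congr' ?_
    filter_upwards [Filter.eventually_gt_atTop (1:ℝ)] with x hx
    rw [Function.update_of_ne (ne_of_gt hx)]

set_option linter.unusedSimpArgs false

lemma ww_ge (a b t : ℝ) (ha : 0 < a) (hb : 0 < b) (ht : 1 ≤ t) : Real.cosh (a + b) ≤ ww a b t := by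
  have h1 := Real.sinh_pos_iff.2 ha
  have h2 := Real.sinh_pos_iff.2 hb
  rw [Real.cosh_add]
  unfold ww
  have := mul_pos h1 h2
  nlinarith

lemma ww_gt_one (a b t : ℝ) (ha : 0 < a) (hb : 0 < b) (ht : 1 ≤ t) : 1 < ww a b t :=
  lt_of_lt_of_le (Real.one_lt_cosh.2 (by positivity)) (ww_ge a b t ha hb ht)

lemma ww_hasDerivAt_a (a b t : ℝ) : HasDerivAt (fun a => ww a b t) (wa a b t) a := by
  unfold ww wa
  exact ((Real.hasDerivAt_cosh a).mul_const _).add (((Real.hasDerivAt_sinh a).mul_const _).mul_const _)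

lemma wa_hasDerivAt_a (a b t : ℝ) : HasDerivAt (fun a => wa a b t) (ww a b t) a := by
  unfold ww wa
  exact ((Real.hasDerivAt_sinh a).mul_const _).add (((Real.hasDerivAt_cosh a).mul_const _).mul_const _)

lemma ww_hasDerivAt_t (a b t : ℝ) : HasDerivAt (fun t => ww a b t) (Real.sinh a * Real.sinh b) t := by
  unfold ww
  simpa using ((hasDerivAt_id t).const_mul (Real.sinh a * Real.sinh b)).const_add (Real.cosh a * Real.cosh b)

lemma cont_ww (a b : ℝ) : Continuous (ww a b) := by unfold ww; fun_prop
lemma cont_wa (a b : ℝ) : Continuous (wa a b) := by unfold wa; fun_prop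

lemma cont_comp_ww (f : ℝ → ℂ) (hf : ContinuousOn f (Ioi 1)) (a b : ℝ) (ha : 0 < a) (hb : 0 < b) :
    ContinuousOn (fun t => f (ww a b t)) (Ioi 1) :=
  hf.comp (cont_ww a b).continuousOn (fun t (ht : 1 < t) => ww_gt_one a b t ha hb ht.le)

/-- bounds locally uniform in `a` -/
lemma ww_bounds (a₀ b : ℝ) (ha : 0 < a₀) (hb : 0 < b) : ∃ w₀ m M : ℝ, 1 < w₀ ∧ 0 < m ∧ 0 < M ∧
    ∀ a ∈ Ioo (a₀ / 2) (2 * a₀), ∀ t, 1 ≤ t → w₀ ≤ ww a b t ∧ m * t ≤ ww a b t ∧ ww a b t ≤ M * t ∧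
      0 ≤ wa a b t ∧ wa a b t ≤ M * t := by
  have hsb := Real.sinh_pos_iff.2 hb
  have hcb := Real.one_lt_cosh.2 hb.ne'
  refine ⟨Real.cosh (a₀ / 2), Real.sinh (a₀ / 2) * Real.sinh b, Real.cosh (2 * a₀) * Real.cosh b + Real.cosh (2 * a₀) * Real.sinh b,
    Real.one_lt_cosh.2 (by positivity), mul_pos (Real.sinh_pos_iff.2 (by positivity)) hsb, ?_, ?_⟩
  · have := Real.cosh_pos (2 * a₀)
    positivity
  intro a ⟨h1, h2⟩ t ht
  have hap : 0 < a := by linarith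
  have c1 : Real.cosh (a₀ / 2) ≤ Real.cosh a := by
    rw [Real.cosh_le_cosh, abs_of_pos (by positivity), abs_of_pos hap]; exact h1.le
  have c2 : Real.cosh a ≤ Real.cosh (2 * a₀) := by
    rw [Real.cosh_le_cosh, abs_of_pos (by positivity), abs_of_pos (by positivity)]; exact h2.le
  have c3 : Real.sinh (a₀ / 2) ≤ Real.sinh a := Real.sinh_le_sinh.2 h1.le
  have c4 : Real.sinh a ≤ Real.cosh a := (Real.sinh_lt_cosh a).le
  have c5 : 0 < Real.sinh a := Real.sinh_pos_iff.2 hap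
  have c6 : 0 < Real.cosh a := Real.cosh_pos a
  have c7 : 0 < Real.sinh (a₀ / 2) := Real.sinh_pos_iff.2 (by positivity)
  have ht0 : 0 < t := by linarith
  have d1 : Real.cosh (2 * a₀) * Real.cosh b ≤ Real.cosh (2 * a₀) * Real.cosh b * t :=
    le_mul_of_one_le_right (by positivity) ht
  have d2 : Real.sinh a * Real.sinh b * t ≤ Real.cosh (2 * a₀) * Real.sinh b * t := by
    gcongr; linarith
  have d3 : Real.cosh a * Real.sinh b * t ≤ Real.cosh (2 * a₀) * Real.sinh b * t := by gcongr
  have d4 : Real.cosh a * Real.cosh b ≤ Real.cosh (2 * a₀) * Real.cosh b := by gcongr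
  have d5 : Real.sinh a * Real.cosh b ≤ Real.cosh (2 * a₀) * Real.cosh b := by gcongr; linarith
  have d6 : Real.sinh (a₀ / 2) * Real.sinh b * t ≤ Real.sinh a * Real.sinh b * t := by gcongr
  have d7 : Real.cosh a ≤ Real.cosh a * Real.cosh b := le_mul_of_one_le_right c6.le hcb.le
  have d8 : 0 < Real.sinh a * Real.sinh b * t := by positivity
  have d9 : 0 < Real.cosh a * Real.cosh b := by positivity
  unfold ww wa
  refine ⟨by linarith, by linarith, by linarith, by positivity, by linarith⟩

lemma diff_under (p : ℂ) (e K a₀ : ℝ) (s : Set ℝ) (hs : s ∈ nhds a₀) (hp : 0 < p.re)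
    (he : e + 2 * (p.re - 1) < -1) (G G' : ℝ → ℝ → ℂ)
    (hd : ∀ a ∈ s, ∀ t, 1 < t → HasDerivAt (fun a => G a t) (G' a t) a)
    (hG : ∀ t, 1 < t → ‖G a₀ t‖ ≤ K * t ^ e) (hG' : ∀ a ∈ s, ∀ t, 1 < t → ‖G' a t‖ ≤ K * t ^ e)
    (hc : ∀ a ∈ s, ContinuousOn (G a) (Ioi 1)) (hc' : ContinuousOn (G' a₀) (Ioi 1)) :
    HasDerivAt (fun a => ∫ t in Ioi (1:ℝ), G a t * om (p - 1) t)
      (∫ t in Ioi (1:ℝ), G' a₀ t * om (p - 1) t) a₀ := by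
  have hI := (integrable_pw e (p.re - 1) (by linarith) he).const_mul K
  have hom := cont_om (p - 1)
  have hb : ∀ z : ℂ, ∀ t : ℝ, 1 < t → ‖z‖ ≤ K * t ^ e → ‖z * om (p - 1) t‖ ≤ K * (t ^ e * (t ^ 2 - 1) ^ (p.re - 1)) := by
    intro z t ht hz
    have := sq_sub_pos ht
    rw [norm_mul, om_norm _ _ ht, Complex.sub_re, Complex.one_re, ← mul_assoc]
    gcongr
  refine (hasDerivAt_integral_of_dominated_loc_of_deriv_le (μ := volume.restrict (Ioi 1)) (𝕜 := ℝ) (F := fun a t => G a t * om (p - 1) t)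
    (F' := fun a t => G' a t * om (p - 1) t) (s := s) (bound := fun t => K * (t ^ e * (t ^ 2 - 1) ^ (p.re - 1))) hs ?_ ?_ ?_ ?_ hI ?_).2
  · filter_upwards [hs] with a ha
    exact ((hc a ha).mul hom).aestronglyMeasurable measurableSet_Ioi
  · refine Integrable.mono' hI (((hc a₀ (mem_of_mem_nhds hs)).mul hom).aestronglyMeasurable measurableSet_Ioi) ?_
    exact (ae_restrict_iff' measurableSet_Ioi).2 (Filter.Eventually.of_forall fun t ht => hb _ t ht (hG t ht))
  · exact (hc'.mul hom).aestronglyMeasurable measurableSet_Ioi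
  · exact (ae_restrict_iff' measurableSet_Ioi).2 (Filter.Eventually.of_forall fun t ht a ha => hb _ t ht (hG' a ha t ht))
  · exact (ae_restrict_iff' measurableSet_Ioi).2 (Filter.Eventually.of_forall fun t ht a ha => (hd a ha t ht).mul_const _)

noncomputable def g1 (σ p : ℂ) (a b t : ℝ) : ℂ := v1 σ p (ww a b t) * wa a b t
noncomputable def g2 (σ p : ℂ) (a b t : ℝ) : ℂ :=
  v2 σ p (ww a b t) * (wa a b t) ^ 2 + v1 σ p (ww a b t) * ww a b t

lemma g_bounds (σ p : ℂ) (a₀ b : ℝ) (ha : 0 < a₀) (hb : 0 < b) (hl : (σ - 2 * p).re < 0) :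
    ∃ K : ℝ, 0 < K ∧ ∀ a ∈ Ioo (a₀ / 2) (2 * a₀), ∀ t, 1 < t →
      ‖vv σ p (ww a b t)‖ ≤ K * t ^ (σ - 2 * p).re ∧ ‖g1 σ p a b t‖ ≤ K * t ^ (σ - 2 * p).re ∧
      ‖g2 σ p a b t‖ ≤ K * t ^ (σ - 2 * p).re ∧ ‖v1 σ p (ww a b t)‖ ≤ K * t ^ ((σ - 2 * p).re - 1) ∧
      ‖v2 σ p (ww a b t)‖ ≤ K * t ^ ((σ - 2 * p).re - 2) := by
  obtain ⟨w₀, m, M, hw₀, hm, hM, H⟩ := ww_bounds a₀ b ha hb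
  obtain ⟨K, hK, hv⟩ := v_bound (max ‖σ‖ ‖p‖) w₀ (by positivity) hw₀
  set l := (σ - 2 * p).re
  set A0 := K * m ^ l
  set A1 := K * m ^ (l - 1)
  set A2 := K * m ^ (l - 2)
  have hA0 : 0 < A0 := by positivity
  have hA1 : 0 < A1 := by positivity
  have hA2 : 0 < A2 := by positivity
  refine ⟨A0 + A1 + A2 + A1 * M + A2 * M ^ 2, by positivity, fun a ha t ht => ?_⟩
  obtain ⟨h1, h2, h3, h4, h5⟩ := H a ha t ht.le
  obtain ⟨b0, b1, b2⟩ := hv σ p (le_max_left _ _) (le_max_right _ _) _ h1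
  have ht0 : 0 < t := by linarith
  have hmt : 0 < m * t := by positivity
  have hwp : 0 < ww a b t := by linarith
  have c : ∀ r : ℝ, r ≤ 0 → (ww a b t) ^ r ≤ m ^ r * t ^ r := fun r hr => by
    rw [← Real.mul_rpow hm.le ht0.le]
    exact Real.rpow_le_rpow_of_nonpos hmt h2 hr
  have c0 : ‖vv σ p (ww a b t)‖ ≤ A0 * t ^ l := by
    calc _ ≤ K * (m ^ l * t ^ l) := b0.trans (by gcongr; exact c _ hl.le)
      _ = _ := by ring
  have c1 : ‖v1 σ p (ww a b t)‖ ≤ A1 * t ^ (l - 1) := by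
    calc _ ≤ K * (m ^ (l-1) * t ^ (l-1)) := b1.trans (by gcongr; exact c _ (by linarith))
      _ = _ := by ring
  have c2 : ‖v2 σ p (ww a b t)‖ ≤ A2 * t ^ (l - 2) := by
    calc _ ≤ K * (m ^ (l-2) * t ^ (l-2)) := b2.trans (by gcongr; exact c _ (by linarith))
      _ = _ := by ring
  have e1 : t ^ (l - 1) * t = t ^ l := by rw [Real.rpow_sub_one ht0.ne']; field_simp
  have e2 : t ^ (l - 2) * t ^ 2 = t ^ l := by
    rw [Real.rpow_sub ht0]; norm_num; field_simp
  have q0 : 0 ≤ A1 * M := by positivity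
  have q1 : 0 ≤ A2 * M ^ 2 := by positivity
  have n1 : ‖(wa a b t : ℂ)‖ ≤ M * t := by rw [Complex.norm_real, Real.norm_of_nonneg h4]; exact h5
  have n2 : ‖(ww a b t : ℂ)‖ ≤ M * t := by rw [Complex.norm_real, Real.norm_of_nonneg hwp.le]; exact h3
  have d1 : ‖g1 σ p a b t‖ ≤ A1 * M * t ^ l := by
    unfold g1
    rw [norm_mul]
    calc _ ≤ (A1 * t ^ (l - 1)) * (M * t) := by gcongr
      _ = _ := by rw [← e1]; ring
  have d2 : ‖g2 σ p a b t‖ ≤ (A2 * M ^ 2 + A1 * M) * t ^ l := by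
    unfold g2
    refine (norm_add_le _ _).trans ?_
    rw [norm_mul, norm_mul, norm_pow]
    calc _ ≤ (A2 * t ^ (l - 2)) * (M * t) ^ 2 + (A1 * t ^ (l - 1)) * (M * t) := by gcongr
      _ = A2 * M ^ 2 * (t ^ (l - 2) * t ^ 2) + A1 * M * (t ^ (l - 1) * t) := by ring
      _ = _ := by rw [e1, e2]; ring
  refine ⟨c0.trans ?_, d1.trans ?_, d2.trans ?_, c1.trans ?_, c2.trans ?_⟩
  all_goals exact mul_le_mul_of_nonneg_right (by linarith) (by positivity)

noncomputable def U0 (σ p : ℂ) (a b : ℝ) : ℂ := ∫ t in Ioi (1:ℝ), vv σ p (ww a b t) * om (p - 1) t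
noncomputable def U1 (σ p : ℂ) (a b : ℝ) : ℂ := ∫ t in Ioi (1:ℝ), g1 σ p a b t * om (p - 1) t
noncomputable def U2 (σ p : ℂ) (a b : ℝ) : ℂ := ∫ t in Ioi (1:ℝ), g2 σ p a b t * om (p - 1) t

lemma cont_g1 (σ p : ℂ) (a b : ℝ) (ha : 0 < a) (hb : 0 < b) : ContinuousOn (g1 σ p a b) (Ioi 1) := by
  unfold g1
  have h1 := cont_comp_ww _ (cont_v1 σ p) a b ha hb
  have h2 := cont_wa a b
  exact h1.mul (by fun_prop)

lemma cont_g2 (σ p : ℂ) (a b : ℝ) (ha : 0 < a) (hb : 0 < b) : ContinuousOn (g2 σ p a b) (Ioi 1) := by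
  unfold g2
  have h1 := cont_comp_ww _ (cont_v1 σ p) a b ha hb
  have h3 := cont_comp_ww _ (cont_v2 σ p) a b ha hb
  have h2 := cont_wa a b
  have h4 := cont_ww a b
  exact (h3.mul (by fun_prop)).add (h1.mul (by fun_prop))

lemma g1_hd (σ p : ℂ) (a b t : ℝ) (h : 1 < ww a b t) :
    HasDerivAt (fun a => vv σ p (ww a b t)) (g1 σ p a b t) a := by
  refine ((vv_hasDerivAt σ p _ h).scomp a (ww_hasDerivAt_a a b t)).congr_deriv ?_
  simp [g1, mul_comm]

lemma g2_hd (σ p : ℂ) (a b t : ℝ) (h : 1 < ww a b t) :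
    HasDerivAt (fun a => g1 σ p a b t) (g2 σ p a b t) a := by
  have h1 := ((v1_hasDerivAt σ p _ h).scomp a (ww_hasDerivAt_a a b t))
  refine (h1.mul (wa_hasDerivAt_a a b t).ofReal_comp).congr_deriv ?_
  simp [g2]; ring

lemma U0_hasDerivAt (σ p : ℂ) (hp : 0 < p.re) (hl : (σ - 2 * p).re < 0) (hσ : σ.re < 1) (a b : ℝ) (ha : 0 < a) (hb : 0 < b) :
    HasDerivAt (fun a => U0 σ p a b) (U1 σ p a b) a := by
  obtain ⟨K, hK, H⟩ := g_bounds σ p a b ha hb hl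
  have hmem : Ioo (a / 2) (2 * a) ∈ nhds a := Ioo_mem_nhds (by linarith) (by linarith)
  have pos : ∀ x ∈ Ioo (a / 2) (2 * a), 0 < x := fun x hx => by linarith [hx.1]
  refine diff_under p (σ - 2 * p).re K a _ hmem hp (by simp at *; linarith)
    (fun a t => vv σ p (ww a b t)) (fun a t => g1 σ p a b t) ?_ ?_ ?_ ?_ ?_
  · exact fun x hx t ht => g1_hd σ p x b t (ww_gt_one x b t (pos x hx) hb ht.le)
  · exact fun t ht => (H a (mem_of_mem_nhds hmem) t ht).1
  · exact fun x hx t ht => (H x hx t ht).2.1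
  · exact fun x hx => cont_comp_ww _ (cont_vv σ p) x b (pos x hx) hb
  · exact cont_g1 σ p a b ha hb

lemma U1_hasDerivAt (σ p : ℂ) (hp : 0 < p.re) (hl : (σ - 2 * p).re < 0) (hσ : σ.re < 1) (a b : ℝ) (ha : 0 < a) (hb : 0 < b) :
    HasDerivAt (fun a => U1 σ p a b) (U2 σ p a b) a := by
  obtain ⟨K, hK, H⟩ := g_bounds σ p a b ha hb hl
  have hmem : Ioo (a / 2) (2 * a) ∈ nhds a := Ioo_mem_nhds (by linarith) (by linarith)
  have pos : ∀ x ∈ Ioo (a / 2) (2 * a), 0 < x := fun x hx => by linarith [hx.1]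
  refine diff_under p (σ - 2 * p).re K a _ hmem hp (by simp at *; linarith)
    (fun a t => g1 σ p a b t) (fun a t => g2 σ p a b t) ?_ ?_ ?_ ?_ ?_
  · exact fun x hx t ht => g2_hd σ p x b t (ww_gt_one x b t (pos x hx) hb ht.le)
  · exact fun t ht => (H a (mem_of_mem_nhds hmem) t ht).2.1
  · exact fun x hx t ht => (H x hx t ht).2.2.1
  · exact fun x hx => cont_g1 σ p x b (pos x hx) hb
  · exact cont_g2 σ p a b ha hb

lemma integrable_of_bd (σ p : ℂ) (hp : 0 < p.re) (hσ : σ.re < 1) (K : ℝ) (f : ℝ → ℂ) (hf : ContinuousOn f (Ioi 1))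
    (h : ∀ t, 1 < t → ‖f t‖ ≤ K * t ^ (σ - 2 * p).re) :
    IntegrableOn (fun t => f t * om (p - 1) t) (Ioi 1) := by
  have hI := (integrable_pw (σ - 2 * p).re (p.re - 1) (by linarith) (by simp at *; linarith)).const_mul K
  refine Integrable.mono' hI ((hf.mul (cont_om (p - 1))).aestronglyMeasurable measurableSet_Ioi) ?_
  refine (ae_restrict_iff' measurableSet_Ioi).2 (Filter.Eventually.of_forall fun t (ht : 1 < t) => ?_)
  have := sq_sub_pos ht
  rw [norm_mul, om_norm _ _ ht, Complex.sub_re, Complex.one_re, ← mul_assoc]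
  gcongr
  exact h t ht

lemma om_tendsto_one (p : ℂ) (hp : 0 < p.re) : Filter.Tendsto (om p) (nhdsWithin 1 (Ioi 1)) (nhds 0) := by
  rw [tendsto_zero_iff_norm_tendsto_zero]
  have h1 : Filter.Tendsto (fun t : ℝ => (t ^ 2 - 1) ^ p.re) (nhdsWithin 1 (Ioi 1)) (nhds 0) := by
    have : Continuous (fun t : ℝ => (t ^ 2 - 1) ^ p.re) :=
      Continuous.rpow_const (by fun_prop) (fun _ => Or.inr hp.le)
    have h := (this.tendsto 1).mono_left (nhdsWithin_le_nhds (s := Ioi 1))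
    simpa [Real.zero_rpow hp.ne'] using h
  refine h1.congr' ?_
  filter_upwards [self_mem_nhdsWithin] with t ht
  rw [om_norm _ _ ht]

lemma U_pde (σ p : ℂ) (hp : 0 < p.re) (hl : (σ - 2 * p).re < 0) (hσ : σ.re < 1) (a b : ℝ) (ha : 0 < a) (hb : 0 < b) :
    Real.sinh a * U2 σ p a b + 2 * p * Real.cosh a * U1 σ p a b =
      (σ - 2 * p) * σ * Real.sinh a * U0 σ p a b := by
  obtain ⟨K, hK, H⟩ := g_bounds σ p a b ha hb hl
  have hmem : a ∈ Ioo (a / 2) (2 * a) := ⟨by linarith, by linarith⟩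
  have i0 := integrable_of_bd σ p hp hσ K _ (cont_comp_ww _ (cont_vv σ p) a b ha hb) (fun t ht => (H a hmem t ht).1)
  have i1 := integrable_of_bd σ p hp hσ K _ (cont_g1 σ p a b ha hb) (fun t ht => (H a hmem t ht).2.1)
  have i2 := integrable_of_bd σ p hp hσ K _ (cont_g2 σ p a b ha hb) (fun t ht => (H a hmem t ht).2.2.1)
  have hsa : (Real.sinh a : ℂ) ≠ 0 := by exact_mod_cast (Real.sinh_pos_iff.2 ha).ne'
  have hcs : (Real.cosh a : ℂ) ^ 2 - (Real.sinh a : ℂ) ^ 2 = 1 := by exact_mod_cast Real.cosh_sq_sub_sinh_sq a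
  have hcsb : (Real.cosh b : ℂ) ^ 2 - (Real.sinh b : ℂ) ^ 2 = 1 := by exact_mod_cast Real.cosh_sq_sub_sinh_sq b
  set f' : ℝ → ℂ := fun t => (Real.sinh a * (g2 σ p a b t * om (p - 1) t) + 2 * p * Real.cosh a * (g1 σ p a b t * om (p - 1) t)
    - (σ - 2 * p) * σ * Real.sinh a * (vv σ p (ww a b t) * om (p - 1) t)) with hf'
  have hint : IntegrableOn f' (Ioi 1) := ((i2.const_mul _).add (i1.const_mul _)).sub (i0.const_mul _)
  have hval : ∫ t in Ioi (1:ℝ), f' t = Real.sinh a * U2 σ p a b + 2 * p * Real.cosh a * U1 σ p a b -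
      (σ - 2 * p) * σ * Real.sinh a * U0 σ p a b := by
    simp only [hf']
    rw [integral_sub, integral_add, integral_const_mul, integral_const_mul, integral_const_mul]
    · rfl
    · exact i2.const_mul _
    · exact i1.const_mul _
    · exact (i2.const_mul _).add (i1.const_mul _)
    · exact i0.const_mul _
  have hz : ∫ t in Ioi (1:ℝ), f' t = 0 := by
    refine ftc0 (fun t => Real.sinh b * (om p t * v1 σ p (ww a b t))) f' ?_ hint ?_ ?_
    · intro t ht
      have hw := ww_gt_one a b t ha hb ht.le
      have h1 := (om_hasDerivAt p t ht).mul ((v1_hasDerivAt σ p _ hw).scomp t (ww_hasDerivAt_t a b t))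
      refine (h1.const_mul _).congr_deriv ?_
      simp only [hf', g2, g1, Function.comp]
      rw [om_succ p t ht]
      have hw2 : ((ww a b t ^ 2 - 1 : ℝ) : ℂ) ≠ 0 := by exact_mod_cast (sq_sub_pos hw).ne'
      have hv2 : v2 σ p (ww a b t) * ((ww a b t ^ 2 - 1 : ℝ) : ℂ) =
          (σ - 2 * p) * σ * vv σ p (ww a b t) - (2 * p + 1) * ww a b t * v1 σ p (ww a b t) := by
        unfold v2; field_simp
      have ew1 : (wa a b t : ℂ) ^ 2 = ((ww a b t ^ 2 - 1 : ℝ) : ℂ) + (Real.sinh b : ℂ) ^ 2 * (t ^ 2 - 1) := by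
        unfold wa ww; simp only [Complex.ofReal_add, Complex.ofReal_mul, Complex.ofReal_sub, Complex.ofReal_pow, Complex.ofReal_one]
        linear_combination ((Real.sinh b : ℂ) ^ 2 * t ^ 2 - (Real.cosh b : ℂ) ^ 2) * hcs - hcsb
      have ew2 : (Real.cosh a : ℂ) * wa a b t - Real.sinh a * ww a b t = Real.sinh b * t := by
        unfold wa ww; simp only [Complex.ofReal_add, Complex.ofReal_mul, Complex.ofReal_sub, Complex.ofReal_pow, Complex.ofReal_one]
        linear_combination ((Real.sinh b : ℂ) * t) * hcs
      rw [ew1, Complex.real_smul]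
      simp only [Complex.ofReal_add, Complex.ofReal_mul, Complex.ofReal_sub, Complex.ofReal_pow, Complex.ofReal_one] at hv2 ⊢
      linear_combination (-(Real.sinh a : ℂ) * om (p - 1) t) * hv2 - (2 * p * om (p - 1) t * v1 σ p (ww a b t)) * ew2
    · have h1 := om_tendsto_one p hp
      have h2 : Filter.Tendsto (fun t => v1 σ p (ww a b t)) (nhdsWithin 1 (Ioi 1)) (nhds (v1 σ p (ww a b 1))) := by
        have : ContinuousAt (fun t => v1 σ p (ww a b t)) 1 :=
          ContinuousAt.comp (f := ww a b) (v1_hasDerivAt σ p _ (ww_gt_one a b 1 ha hb le_rfl)).continuousAt (cont_ww a b).continuousAt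
        exact this.tendsto.mono_left nhdsWithin_le_nhds
      simpa using (h1.mul h2).const_mul (Real.sinh b : ℂ)
    · have h1 : Filter.Tendsto (fun t => om p t * v1 σ p (ww a b t)) Filter.atTop (nhds 0) := by
        have h3 : Filter.Tendsto (fun t : ℝ => K * t ^ (-(1 - σ.re))) Filter.atTop (nhds 0) := by
          simpa using (tendsto_rpow_neg_atTop (show 0 < 1 - σ.re by linarith)).const_mul K
        refine squeeze_zero_norm' ?_ h3
        filter_upwards [Filter.eventually_gt_atTop (1:ℝ)] with t ht
        have ht0 : 0 < t := by linarith
        have hpos := sq_sub_pos ht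
        rw [norm_mul, om_norm _ _ ht]
        calc _ ≤ (t ^ 2) ^ p.re * (K * t ^ ((σ - 2 * p).re - 1)) := by
              gcongr
              · linarith
              · exact (H a hmem t ht).2.2.2.1
          _ = K * (t ^ (2 * p.re) * t ^ ((σ - 2 * p).re - 1)) := by
            rw [Real.rpow_mul ht0.le]; norm_num; ring
          _ = _ := by
            rw [← Real.rpow_add ht0]; congr 2; simp; ring
      simpa using h1.const_mul (Real.sinh b : ℂ)
  rw [hval] at hz
  exact sub_eq_zero.1 hz


lemma const_of_deriv_zero (f : ℝ → ℂ) (h : ∀ a, 0 < a → HasDerivAt f 0 a) (x y : ℝ) (hx : 0 < x) (hy : 0 < y) :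
    f x = f y := by
  refine (convex_Ioi (0:ℝ)).is_const_of_fderivWithin_eq_zero (𝕜 := ℝ) (f := f)
    (fun a ha => (h a ha).differentiableAt.differentiableWithinAt) ?_ hx hy
  intro a ha
  rw [fderivWithin_of_isOpen isOpen_Ioi ha, (h a ha).hasFDerivAt.fderiv]
  ext; simp

lemma exp_two_ge {a : ℝ} (ha : 1 ≤ a) : 3 * Real.exp (-a) ≤ Real.exp a := by
  have h1 := Real.add_one_le_exp (2 * a)
  have h2 : Real.exp (2 * a) * Real.exp (-a) = Real.exp a := by rw [← Real.exp_add]; ring_nf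
  have h3 := Real.exp_pos (-a)
  nlinarith

lemma cosh_le_two_sinh {a : ℝ} (ha : 1 ≤ a) : Real.cosh a ≤ 2 * Real.sinh a := by
  have := exp_two_ge ha
  rw [Real.cosh_eq, Real.sinh_eq]; linarith

lemma sinh_ge_exp {a : ℝ} (ha : 1 ≤ a) : Real.exp a / 3 ≤ Real.sinh a := by
  have := exp_two_ge ha
  rw [Real.sinh_eq]; linarith

lemma norm_int_le (e K : ℝ) (p : ℝ) (f : ℝ → ℂ) (A : ℝ) 
    (h : ∀ t, 1 < t → ‖f t‖ ≤ A * t ^ e) (hI : IntegrableOn (fun t : ℝ => t ^ e * (t ^ 2 - 1) ^ (p - 1)) (Ioi 1))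
    (hK : K = ∫ t in Ioi (1:ℝ), t ^ e * (t ^ 2 - 1) ^ (p - 1)) :
    ‖∫ t in Ioi (1:ℝ), f t * om (p - 1) t‖ ≤ A * K := by
  rw [hK, ← integral_const_mul]
  refine norm_integral_le_of_norm_le (hI.const_mul A) ?_
  refine (ae_restrict_iff' measurableSet_Ioi).2 (Filter.Eventually.of_forall fun t (ht : 1 < t) => ?_)
  have := sq_sub_pos ht
  rw [norm_mul, om_norm _ _ ht, ← mul_assoc]
  simp only [Complex.sub_re, Complex.ofReal_re, Complex.one_re]
  gcongr
  exact h t ht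

lemma U_large (σ p : ℝ) (hσ : σ < 0) (hp : 0 < p) (b : ℝ) (hb : 0 < b) : ∃ K : ℝ, 0 ≤ K ∧ ∀ a, 1 ≤ a →
    ‖U0 σ p a b‖ ≤ K * Real.sinh a ^ (σ - 2 * p) ∧ ‖U1 σ p a b‖ ≤ K * Real.sinh a ^ (σ - 2 * p) := by
  obtain ⟨K, hK, hv⟩ := v_bound (max ‖(σ:ℂ)‖ ‖(p:ℂ)‖) (Real.cosh (1 + b)) (by positivity) (Real.one_lt_cosh.2 (by positivity))
  have hI := integrable_pw (σ - 2 * p) (p - 1) (by linarith) (by linarith)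
  set I := ∫ t in Ioi (1:ℝ), t ^ (σ - 2 * p) * (t ^ 2 - 1) ^ (p - 1) with hIdef
  have hI0 : 0 ≤ I := setIntegral_nonneg measurableSet_Ioi fun t (ht : 1 < t) => by
    have := sq_sub_pos ht
    have : 0 < t := by linarith
    positivity
  have hsb := Real.sinh_pos_iff.2 hb
  have hre : ((σ : ℂ) - 2 * p).re = σ - 2 * p := by simp
  refine ⟨2 * K * Real.sinh b ^ (σ - 2 * p) * I, by positivity, fun a ha => ?_⟩
  have ha0 : 0 < a := by linarith
  have hsa := Real.sinh_pos_iff.2 ha0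
  have key : ∀ t, 1 < t → ‖vv σ p (ww a b t)‖ ≤ 2 * K * Real.sinh b ^ (σ - 2 * p) * Real.sinh a ^ (σ - 2 * p) * t ^ (σ - 2 * p) ∧
      ‖g1 σ p a b t‖ ≤ 2 * K * Real.sinh b ^ (σ - 2 * p) * Real.sinh a ^ (σ - 2 * p) * t ^ (σ - 2 * p) := by
    intro t ht
    have ht0 : 0 < t := by linarith
    have hw : Real.cosh (1 + b) ≤ ww a b t := by
      refine le_trans ?_ (ww_ge a b t ha0 hb ht.le)
      rw [Real.cosh_le_cosh, abs_of_pos (by positivity), abs_of_pos (by positivity)]; linarith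
    have hw1 := ww_gt_one a b t ha0 hb ht.le
    have hw0 : 0 < ww a b t := by linarith
    obtain ⟨b0, b1, -⟩ := hv σ p (le_max_left _ _) (le_max_right _ _) _ hw
    rw [hre] at b0 b1
    have hca := Real.cosh_pos a
    have hcb := Real.cosh_pos b
    have hlow : Real.sinh a * Real.sinh b * t ≤ ww a b t := by
      unfold ww; nlinarith [mul_pos hca hcb]
    have hpw : ww a b t ^ (σ - 2 * p) ≤ Real.sinh a ^ (σ - 2 * p) * Real.sinh b ^ (σ - 2 * p) * t ^ (σ - 2 * p) := by
      rw [← Real.mul_rpow hsa.le hsb.le, ← Real.mul_rpow (by positivity) ht0.le]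
      exact Real.rpow_le_rpow_of_nonpos (by positivity) hlow (by linarith)
    have hwa0 : 0 ≤ wa a b t := by unfold wa; positivity
    have hwa : wa a b t ≤ 2 * ww a b t := by
      unfold wa ww
      have c1 := cosh_le_two_sinh ha
      have c2 := (Real.sinh_lt_cosh a).le
      have := mul_le_mul_of_nonneg_right c1 (mul_pos hsb ht0).le
      have := mul_le_mul_of_nonneg_right c2 hcb.le
      nlinarith [mul_pos hca hcb]
    set Q := Real.sinh a ^ (σ - 2 * p) * Real.sinh b ^ (σ - 2 * p) * t ^ (σ - 2 * p) with hQ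
    have hQ0 : 0 ≤ Q := by positivity
    have e1 : 2 * K * Real.sinh b ^ (σ - 2 * p) * Real.sinh a ^ (σ - 2 * p) * t ^ (σ - 2 * p) = 2 * K * Q := by rw [hQ]; ring
    rw [e1]
    constructor
    · calc _ ≤ K * Q := b0.trans (by gcongr)
        _ ≤ _ := by nlinarith
    · unfold g1
      rw [norm_mul, Complex.norm_real, Real.norm_of_nonneg hwa0]
      calc _ ≤ (K * ww a b t ^ (σ - 2 * p - 1)) * (2 * ww a b t) := by gcongr
        _ = 2 * K * ww a b t ^ (σ - 2 * p) := by rw [Real.rpow_sub_one hw0.ne']; field_simp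
        _ ≤ _ := by gcongr
  constructor
  · refine (norm_int_le (σ - 2 * p) I p _ _ (fun t ht => (key t ht).1) hI hIdef).trans (le_of_eq (by ring))
  · refine (norm_int_le (σ - 2 * p) I p _ _ (fun t ht => (key t ht).2) hI hIdef).trans (le_of_eq (by ring))

lemma wronskian_zero (σ p : ℝ) (hσ : σ < 0) (hp : 0 < p) (a b : ℝ) (ha : 0 < a) (hb : 0 < b) :
    uu σ p 0 a * U1 σ p a b - uu σ p 1 a * U0 σ p a b = 0 := by
  have hp' : 0 < (p:ℂ).re := by simpa
  have hl' : ((σ:ℂ) - 2 * p).re < 0 := by simp; linarith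
  have hσ' : (σ:ℂ).re < 1 := by simp; linarith
  set W : ℝ → ℂ := fun a => ((Real.sinh a ^ (2 * p) : ℝ) : ℂ) * (uu σ p 0 a * U1 σ p a b - uu σ p 1 a * U0 σ p a b) with hW
  have hd : ∀ a, 0 < a → HasDerivAt W 0 a := by
    intro a ha
    have hs := Real.sinh_pos_iff.2 ha
    have h1 := ((Real.hasDerivAt_sinh a).rpow_const (p := 2 * p) (Or.inl hs.ne')).ofReal_comp
    have h2 := ((uu_hasDerivAt σ p 0 a ha).mul (U1_hasDerivAt σ p hp' hl' hσ' a b ha hb)).sub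
      ((uu_hasDerivAt σ p 1 a ha).mul (U0_hasDerivAt σ p hp' hl' hσ' a b ha hb))
    refine (h1.mul h2).congr_deriv ?_
    have e1 := uu_ode σ p a ha
    have e2 := U_pde σ p hp' hl' hσ' a b ha hb
    rw [Real.rpow_sub_one hs.ne']
    have hs' : (Real.sinh a : ℂ) ≠ 0 := by exact_mod_cast hs.ne'
    simp only [Complex.ofReal_mul, Complex.ofReal_div, Complex.ofReal_ofNat]
    simp only [Pi.mul_apply, Pi.sub_apply]
    field_simp
    linear_combination ((Real.sinh a ^ (2 * p) : ℝ) : ℂ) * ((uu σ p 0 a) * e2 - (U0 σ p a b) * e1)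
  have hlim : Filter.Tendsto W Filter.atTop (nhds 0) := by
    obtain ⟨K, hK, hU⟩ := U_large σ p hσ hp b hb
    obtain ⟨K0, hK0, hu0⟩ := uu_bound (max ‖(σ:ℂ)‖ ‖(p:ℂ)‖) 1 (by positivity) one_pos 0
    obtain ⟨K1, hK1, hu1⟩ := uu_bound (max ‖(σ:ℂ)‖ ‖(p:ℂ)‖) 1 (by positivity) one_pos 1
    have hsinh : Filter.Tendsto Real.sinh Filter.atTop Filter.atTop := by
      have h : Filter.Tendsto (fun a => Real.exp a / 3) Filter.atTop Filter.atTop :=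
        Real.tendsto_exp_atTop.atTop_div_const (by norm_num)
      refine Filter.tendsto_atTop_mono' _ ?_ h
      filter_upwards [Filter.eventually_ge_atTop (1:ℝ)] with a ha using sinh_ge_exp ha
    have h3 := ((tendsto_rpow_neg_atTop (show 0 < 2 * p - 2 * σ by linarith)).comp hsinh).const_mul ((K0 + K1) * K)
    rw [mul_zero] at h3
    refine squeeze_zero_norm' ?_ h3
    filter_upwards [Filter.eventually_ge_atTop (1:ℝ)] with a ha
    have hs := Real.sinh_pos_iff.2 (show 0 < a by linarith)
    obtain ⟨q0, q1⟩ := hU a ha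
    have r0 := hu0 σ p (le_max_left _ _) (le_max_right _ _) a ha
    have r1 := hu1 σ p (le_max_left _ _) (le_max_right _ _) a ha
    have hre : ((σ : ℂ) - 2 * p).re = σ - 2 * p := by simp
    rw [hre] at r0 r1
    have hexp : Real.exp ((σ - 2 * p) * a) ≤ Real.sinh a ^ (σ - 2 * p) := by
      rw [mul_comm, Real.exp_mul]
      refine Real.rpow_le_rpow_of_nonpos hs ?_ (by linarith)
      have := Real.exp_pos a
      have := Real.exp_pos (-a)
      rw [Real.sinh_eq]; linarith
    set S := Real.sinh a ^ (σ - 2 * p) with hS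
    have hS0 : 0 ≤ S := by positivity
    simp only [hW, Function.comp]
    rw [norm_mul, Complex.norm_real, Real.norm_of_nonneg (by positivity)]
    have hn : ‖uu σ p 0 a * U1 σ p a b - uu σ p 1 a * U0 σ p a b‖ ≤ (K0 * S) * (K * S) + (K1 * S) * (K * S) := by
      refine (norm_sub_le _ _).trans ?_
      rw [norm_mul, norm_mul]
      have r0' := r0.trans (mul_le_mul_of_nonneg_left hexp hK0.le)
      have r1' := r1.trans (mul_le_mul_of_nonneg_left hexp hK1.le)
      gcongr
    calc _ ≤ Real.sinh a ^ (2 * p) * ((K0 * S) * (K * S) + (K1 * S) * (K * S)) := by gcongr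
      _ = (K0 + K1) * K * (Real.sinh a ^ (2 * p) * S * S) := by ring
      _ = _ := by rw [hS, ← Real.rpow_add hs, ← Real.rpow_add hs]; congr 2; ring
  have hWa : W a = 0 := by
    have h1 : Filter.Tendsto W Filter.atTop (nhds (W a)) := by
      refine tendsto_const_nhds.congr' ?_
      filter_upwards [Filter.eventually_gt_atTop (0:ℝ)] with x hx
      exact const_of_deriv_zero W hd a x ha hx
    exact tendsto_nhds_unique h1 hlim
  have hs := Real.sinh_pos_iff.2 ha
  have hne : ((Real.sinh a ^ (2 * p) : ℝ) : ℂ) ≠ 0 := by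
    exact_mod_cast (Real.rpow_pos_of_pos hs _).ne'
  exact (mul_eq_zero.1 hWa).resolve_left hne

lemma U0_symm (σ p : ℂ) (a b : ℝ) : U0 σ p a b = U0 σ p b a := by
  unfold U0
  have : ∀ t, ww a b t = ww b a t := fun t => by unfold ww; ring
  simp only [this]

lemma U0_prod (σ p : ℝ) (hσ : σ < 0) (hp : 0 < p) : ∃ k : ℂ, ∀ a b : ℝ, 0 < a → 0 < b →
    U0 σ p a b = k * (uu σ p 0 a * uu σ p 0 b) := by
  have hp' : 0 < (p:ℂ).re := by simpa
  have hl' : ((σ:ℂ) - 2 * p).re < 0 := by simp; linarith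
  have hσ' : (σ:ℂ).re < 1 := by simp; linarith
  have hne : ∀ a, 0 < a → uu σ p 0 a ≠ 0 := fun a ha => uu_ne_zero σ p (by linarith) hp (by linarith) a ha
  have key : ∀ a b : ℝ, 0 < a → 0 < b → U0 σ p a b / uu σ p 0 a = U0 σ p 1 b / uu σ p 0 1 := by
    intro a b ha hb
    refine const_of_deriv_zero (fun a => U0 σ p a b / uu σ p 0 a) ?_ a 1 ha one_pos
    intro x hx
    refine ((U0_hasDerivAt σ p hp' hl' hσ' x b hx hb).div (uu_hasDerivAt σ p 0 x hx) (hne x hx)).congr_deriv ?_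
    have := wronskian_zero σ p hσ hp x b hx hb
    rw [div_eq_zero_iff]; left
    linear_combination this
  refine ⟨U0 σ p 1 1 / (uu σ p 0 1) ^ 2, fun a b ha hb => ?_⟩
  have h1 := key a b ha hb
  have h2 := key b 1 hb one_pos
  rw [U0_symm _ _ b 1] at h2
  have n1 := hne a ha
  have n2 := hne b hb
  have n3 := hne 1 one_pos
  rw [div_eq_div_iff n1 n3] at h1
  rw [div_eq_div_iff n2 n3] at h2
  field_simp
  linear_combination (uu σ p 0 1) * h1 + uu σ p 0 a * h2


lemma om_real (p t : ℝ) (ht : 1 < t) : om p t = (((t ^ 2 - 1) ^ p : ℝ) : ℂ) := by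
  unfold om
  rw [Complex.ofReal_cpow (sq_sub_pos ht).le]

lemma beta_int (σ p : ℝ) (hσ : σ < 0) (hp : 0 < p) :
    ∫ t in Ioi (1:ℝ), ((((1 + t) / 2) ^ (σ - 2 * p) : ℝ) : ℂ) * om (p - 1) t =
      (2:ℂ) ^ (2 * p - 1 : ℂ) * (Complex.Gamma p * Complex.Gamma (1 - σ) / Complex.Gamma (1 - σ + p)) := by
  have hB := Complex.Gamma_mul_Gamma_eq_betaIntegral (s := 1 - σ) (t := p) (by simp; linarith) (by simpa)
  have hG : Complex.Gamma (1 - σ + p) ≠ 0 := Complex.Gamma_ne_zero_of_re_pos (by simp; linarith)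
  have himg : (fun s : ℝ => 2 / s - 1) '' (Ioo 0 1) = Ioi 1 := by
    ext t
    simp only [mem_image, mem_Ioo, mem_Ioi]
    constructor
    · rintro ⟨s, ⟨h0, h1⟩, rfl⟩
      have : 2 < 2 / s := by rw [lt_div_iff₀ h0]; linarith
      linarith
    · intro ht
      refine ⟨2 / (t + 1), ⟨by positivity, by rw [div_lt_one (by linarith)]; linarith⟩, ?_⟩
      have : t + 1 ≠ 0 := by linarith
      field_simp; ring
  have hder : ∀ s ∈ Ioo (0:ℝ) 1, HasDerivWithinAt (fun s : ℝ => 2 / s - 1) (-(2 / s ^ 2)) (Ioo 0 1) s := by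
    intro s hs
    have h := (((hasDerivAt_inv hs.1.ne').const_mul 2).sub_const 1)
    have h' : HasDerivAt (fun s : ℝ => 2 / s - 1) (2 * (-(s ^ 2)⁻¹)) s := by
      simpa [div_eq_mul_inv] using h
    exact (h'.congr_deriv (by field_simp)).hasDerivWithinAt
  have hinj : InjOn (fun s : ℝ => 2 / s - 1) (Ioo 0 1) := by
    intro x hx y hy h
    have hx0 := hx.1.ne'
    have hy0 := hy.1.ne'
    simp only [sub_left_inj] at h
    rw [div_eq_div_iff hx0 hy0] at h
    linarith
  have hsub := integral_image_eq_integral_abs_deriv_smul (s := Ioo (0:ℝ) 1) measurableSet_Ioo hder hinj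
    (fun t => ((((1 + t) / 2) ^ (σ - 2 * p) : ℝ) : ℂ) * om (p - 1) t)
  rw [himg] at hsub
  rw [hsub]
  have hbeta : Complex.betaIntegral (1 - σ) p = ∫ s in Ioo (0:ℝ) 1, ((s ^ (-σ) * (1 - s) ^ (p - 1) : ℝ) : ℂ) := by
    unfold Complex.betaIntegral
    rw [intervalIntegral.integral_of_le zero_le_one, integral_Ioc_eq_integral_Ioo]
    refine setIntegral_congr_fun measurableSet_Ioo fun s hs => ?_
    rw [Complex.ofReal_mul, Complex.ofReal_cpow hs.1.le, Complex.ofReal_cpow (by linarith [hs.2])]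
    push_cast
    congr 2
    ring
  have hrhs : (2:ℂ) ^ (2 * p - 1 : ℂ) * (Complex.Gamma p * Complex.Gamma (1 - σ) / Complex.Gamma (1 - σ + p)) =
      ((2 ^ (2 * p - 1) : ℝ) : ℂ) * ∫ s in Ioo (0:ℝ) 1, ((s ^ (-σ) * (1 - s) ^ (p - 1) : ℝ) : ℂ) := by
    rw [← hbeta, mul_comm (Complex.Gamma p), hB, mul_div_cancel_left₀ _ hG, Complex.ofReal_cpow (by norm_num)]
    push_cast; rfl
  rw [hrhs, ← integral_const_mul]
  refine setIntegral_congr_fun measurableSet_Ioo fun s hs => ?_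
  have h0 : 0 < s := hs.1
  have h1 : 0 < 1 - s := by linarith [hs.2]
  have ht : 1 < 2 / s - 1 := by
    have : 2 < 2 / s := by rw [lt_div_iff₀ h0]; linarith
    linarith
  have ho' : om ((p:ℂ) - 1) (2 / s - 1) = ((((2 / s - 1) ^ 2 - 1) ^ (p - 1) : ℝ) : ℂ) := by
    have := om_real (p - 1) _ ht
    rwa [Complex.ofReal_sub, Complex.ofReal_one] at this
  rw [ho', Complex.real_smul, ← Complex.ofReal_mul, ← Complex.ofReal_mul, ← Complex.ofReal_mul]
  congr 1
  rw [abs_neg, abs_of_pos (by positivity)]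
  have e1 : (1 + (2 / s - 1)) / 2 = s⁻¹ := by field_simp; ring
  have e2 : (2 / s - 1) ^ 2 - 1 = 4 * (1 - s) * (s ^ 2)⁻¹ := by field_simp; ring
  rw [e1, e2, Real.mul_rpow (by positivity) (by positivity), Real.mul_rpow (by positivity) (by positivity),
    Real.inv_rpow (by positivity), Real.inv_rpow (by positivity), ← Real.rpow_neg h0.le, ← Real.rpow_natCast s 2,
    ← Real.rpow_mul h0.le, ← Real.rpow_neg h0.le]
  have e3 : (4:ℝ) ^ (p - 1) = 2 ^ (2 * p - 1) / 2 := by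
    rw [show (4:ℝ) = 2 ^ (2:ℝ) by norm_num, ← Real.rpow_mul (by norm_num), ← Real.rpow_sub_one (by norm_num)]
    congr 1; ring
  have e4 : s ^ (-σ) = s ^ (-((2:ℕ):ℝ)) * s ^ (-(σ - 2 * p)) * s ^ (-(((2:ℕ):ℝ) * (p - 1))) := by
    rw [← Real.rpow_add h0, ← Real.rpow_add h0]; congr 1; push_cast; ring
  have e5 : 2 / s ^ ((2:ℕ):ℝ) = 2 * s ^ (-((2:ℕ):ℝ)) := by rw [Real.rpow_neg h0.le]; rfl
  rw [e3, e4, e5]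
  ring

lemma exp_arcosh_tendsto (t : ℝ) (ht : 1 < t) :
    Filter.Tendsto (fun a => Real.exp (Real.arcosh (ww a a t) - 2 * a)) Filter.atTop (nhds ((1 + t) / 2)) := by
  have hE : Filter.Tendsto (fun a : ℝ => Real.exp (-2 * a)) Filter.atTop (nhds 0) := by
    refine Real.tendsto_exp_atBot.comp ?_
    exact Filter.tendsto_id.const_mul_atTop_of_neg (by norm_num)
  have hcont : Continuous (fun e : ℝ => ((1 + e) ^ 2 + (1 - e) ^ 2 * t) / 4 +
      Real.sqrt ((((1 + e) ^ 2 + (1 - e) ^ 2 * t) / 4) ^ 2 - e ^ 2)) := by fun_prop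
  have h := (hcont.tendsto 0).comp hE
  have hv : ((1 + (0:ℝ)) ^ 2 + (1 - 0) ^ 2 * t) / 4 +
      Real.sqrt ((((1 + (0:ℝ)) ^ 2 + (1 - 0) ^ 2 * t) / 4) ^ 2 - 0 ^ 2) = (1 + t) / 2 := by
    norm_num
    rw [Real.sqrt_sq (by linarith)]; ring
  rw [hv] at h
  refine h.congr' ?_
  filter_upwards [Filter.eventually_gt_atTop (0:ℝ)] with a ha
  simp only [Function.comp]
  have hw := ww_gt_one a a t ha ha ht.le
  rw [show Real.arcosh (ww a a t) - 2 * a = Real.arcosh (ww a a t) + -2 * a by ring, Real.exp_add, Real.exp_arcosh hw.le, add_mul]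
  have hwe : ww a a t * Real.exp (-2 * a) = ((1 + Real.exp (-2 * a)) ^ 2 + (1 - Real.exp (-2 * a)) ^ 2 * t) / 4 := by
    unfold ww
    rw [Real.cosh_eq, Real.sinh_eq]
    have e1 : Real.exp (-2 * a) = Real.exp (-a) ^ 2 := by rw [← Real.exp_nat_mul]; congr 1; push_cast; ring
    have e2 : Real.exp a * Real.exp (-a) = 1 := by rw [← Real.exp_add]; simp
    rw [e1]
    generalize Real.exp a = x at *
    generalize Real.exp (-a) = y at *
    linear_combination ((1 + t) / 4 * (x * y + 1) + (1 - t) / 2 * y ^ 2 ) * e2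
  rw [hwe]
  congr 1
  rw [← hwe]
  have hp := Real.exp_pos (-2 * a)
  rw [show (ww a a t * Real.exp (-2 * a)) ^ 2 - Real.exp (-2 * a) ^ 2 = (ww a a t ^ 2 - 1) * Real.exp (-2 * a) ^ 2 by ring,
    Real.sqrt_mul (sq_sub_pos hw).le, Real.sqrt_sq hp.le]

lemma ww_sq_ge (a t : ℝ) (ha : 1 ≤ a) (ht : 1 < t) : t / 9 * Real.exp (2 * a) ≤ ww a a t := by
  have h1 := sinh_ge_exp ha
  have h2 := Real.exp_pos a
  have e : Real.exp (2 * a) = Real.exp a ^ 2 := by rw [← Real.exp_nat_mul]; congr 1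
  have h3 : (Real.exp a / 3) ^ 2 ≤ Real.sinh a ^ 2 := by gcongr
  have h4 := mul_le_mul_of_nonneg_right h3 (show 0 ≤ t by linarith)
  have := Real.cosh_pos a
  rw [e]
  unfold ww
  nlinarith

lemma U0_diag (σ p : ℝ) (hσ : σ < 0) (hp : 0 < p) :
    Filter.Tendsto (fun a : ℝ => U0 σ p a a * Complex.exp (-(2 * (σ - 2 * p) * a))) Filter.atTop
      (nhds (∫ t in Ioi (1:ℝ), hcf σ p 0 * ((((1 + t) / 2) ^ (σ - 2 * p) : ℝ) : ℂ) * om (p - 1) t)) := by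
  obtain ⟨K, hK, hv⟩ := v_bound (max ‖(σ:ℂ)‖ ‖(p:ℂ)‖) (Real.cosh (1 + 1)) (by positivity) (Real.one_lt_cosh.2 (by norm_num))
  have hI := (integrable_pw (σ - 2 * p) (p - 1) (by linarith) (by linarith)).const_mul (K * (1 / 9) ^ (σ - 2 * p))
  have hre : ((σ : ℂ) - 2 * p).re = σ - 2 * p := by simp
  unfold U0
  simp_rw [← integral_mul_const]
  refine tendsto_integral_filter_of_dominated_convergence
    (fun t : ℝ => K * (1 / 9) ^ (σ - 2 * p) * (t ^ (σ - 2 * p) * (t ^ 2 - 1) ^ (p - 1))) ?_ ?_ hI ?_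
  · filter_upwards [Filter.eventually_gt_atTop (0:ℝ)] with a ha
    exact (((cont_comp_ww _ (cont_vv σ p) a a ha ha).mul (cont_om _)).mul_const _).aestronglyMeasurable measurableSet_Ioi
  · filter_upwards [Filter.eventually_ge_atTop (1:ℝ)] with a ha
    refine (ae_restrict_iff' measurableSet_Ioi).2 (Filter.Eventually.of_forall fun t (ht : 1 < t) => ?_)
    have hpos := sq_sub_pos ht
    have ht0 : 0 < t := by linarith
    have ha0 : 0 < a := by linarith
    have hw : Real.cosh (1 + 1) ≤ ww a a t := by
      refine le_trans ?_ (ww_ge a a t ha0 ha0 ht.le)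
      rw [Real.cosh_le_cosh, abs_of_pos (by positivity), abs_of_pos (by positivity)]; linarith
    obtain ⟨b0, -, -⟩ := hv σ p (le_max_left _ _) (le_max_right _ _) _ hw
    rw [hre] at b0
    have hlow := ww_sq_ge a t ha ht
    have hpw : ww a a t ^ (σ - 2 * p) ≤ (t ^ (σ - 2 * p) * (1 / 9) ^ (σ - 2 * p)) * Real.exp (2 * (σ - 2 * p) * a) := by
      have e : Real.exp (2 * (σ - 2 * p) * a) = Real.exp (2 * a) ^ (σ - 2 * p) := by
        rw [← Real.exp_mul]; congr 1; ring
      rw [e, ← Real.mul_rpow ht0.le (by norm_num), ← Real.mul_rpow (by positivity) (Real.exp_pos _).le]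
      refine Real.rpow_le_rpow_of_nonpos (by positivity) ?_ (by linarith)
      linarith
    rw [norm_mul, norm_mul, om_norm _ _ ht, Complex.norm_exp]
    have er : (-(2 * ((σ:ℂ) - 2 * p) * a)).re = -(2 * (σ - 2 * p) * a) := by
      have : (-(2 * ((σ:ℂ) - 2 * p) * a)) = ((-(2 * (σ - 2 * p) * a) : ℝ) : ℂ) := by push_cast; ring
      rw [this, Complex.ofReal_re]
    rw [er]
    simp only [Complex.sub_re, Complex.ofReal_re, Complex.one_re]
    have hb := b0.trans (mul_le_mul_of_nonneg_left hpw hK.le)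
    calc _ ≤ K * ((t ^ (σ - 2 * p) * (1 / 9) ^ (σ - 2 * p)) * Real.exp (2 * (σ - 2 * p) * a)) * (t ^ 2 - 1) ^ (p - 1)
          * Real.exp (-(2 * (σ - 2 * p) * a)) := by gcongr
      _ = K * (1 / 9) ^ (σ - 2 * p) * (t ^ (σ - 2 * p) * (t ^ 2 - 1) ^ (p - 1)) *
          (Real.exp (2 * (σ - 2 * p) * a) * Real.exp (-(2 * (σ - 2 * p) * a))) := by ring
      _ = _ := by rw [← Real.exp_add]; simp
  · refine (ae_restrict_iff' measurableSet_Ioi).2 (Filter.Eventually.of_forall fun t (ht : 1 < t) => ?_)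
    have ht0 : 0 < t := by linarith
    have hE := exp_arcosh_tendsto t ht
    have hE2 : Filter.Tendsto (fun a => ((Real.exp (Real.arcosh (ww a a t) - 2 * a) ^ (σ - 2 * p) : ℝ) : ℂ)) Filter.atTop
        (nhds ((((1 + t) / 2) ^ (σ - 2 * p) : ℝ) : ℂ)) :=
      (Complex.continuous_ofReal.tendsto _).comp (hE.rpow_const (Or.inl (by positivity)))
    have hA : Filter.Tendsto (fun a => Real.arcosh (ww a a t)) Filter.atTop Filter.atTop := by
      refine Filter.tendsto_atTop_mono' _ ?_ Filter.tendsto_id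
      filter_upwards [Filter.eventually_gt_atTop (0:ℝ)] with a ha
      have h1 := ww_ge a a t ha ha ht.le
      have h2 : Real.arcosh (Real.cosh (a + a)) ≤ Real.arcosh (ww a a t) :=
        (Real.arcosh_le_arcosh (Real.cosh_pos _) (by linarith [ww_gt_one a a t ha ha ht.le])).2 h1
      rw [Real.arcosh_cosh (by linarith)] at h2
      simp only [id]; linarith
    have hU := (uu_tendsto σ p).comp hA
    have h := (hU.mul hE2).mul_const (om (p - 1) t)
    refine h.congr fun a => ?_
    simp only [Function.comp, vv]
    have : Complex.exp (-(2 * ((σ:ℂ) - 2 * p) * a)) = Complex.exp (-(((σ:ℂ) - 2 * p) * (Real.arcosh (ww a a t) : ℝ))) *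
        ((Real.exp (Real.arcosh (ww a a t) - 2 * a) ^ (σ - 2 * p) : ℝ) : ℂ) := by
      rw [← Real.exp_mul, Complex.ofReal_exp, ← Complex.exp_add]
      congr 1; push_cast; ring
    rw [this]; ring

lemma U0_formula (σ p : ℝ) (hσ : σ < 0) (hp : 0 < p) (a b : ℝ) (ha : 0 < a) (hb : 0 < b) :
    U0 σ p a b = (2:ℂ) ^ (2 * p - 1 : ℂ) * Complex.Gamma p * Complex.Gamma (1 - σ) * uu σ p 0 a * uu σ p 0 b := by
  obtain ⟨k, hk⟩ := U0_prod σ p hσ hp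
  have hG : Complex.Gamma (1 - σ + p) ≠ 0 := Complex.Gamma_ne_zero_of_re_pos (by simp; linarith)
  have hh : hcf σ p 0 = 1 / Complex.Gamma (1 - σ + p) := by simp [hcf]
  have h1 := U0_diag σ p hσ hp
  have h2 := (((uu_tendsto σ p).mul (uu_tendsto σ p)).const_mul k)
  have h3 : Filter.Tendsto (fun a : ℝ => U0 σ p a a * Complex.exp (-(2 * (σ - 2 * p) * a))) Filter.atTop
      (nhds (k * (hcf σ p 0 * hcf σ p 0))) := by
    refine h2.congr' ?_
    filter_upwards [Filter.eventually_gt_atTop (0:ℝ)] with a ha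
    rw [hk a a ha ha]
    have : Complex.exp (-(2 * ((σ:ℂ) - 2 * p) * a)) = Complex.exp (-(((σ:ℂ) - 2 * p) * a)) * Complex.exp (-(((σ:ℂ) - 2 * p) * a)) := by
      rw [← Complex.exp_add]; congr 1; ring
    rw [this]; ring
  have h4 := tendsto_nhds_unique h3 h1
  simp_rw [mul_assoc] at h4
  rw [integral_const_mul, beta_int σ p hσ hp, hh] at h4
  have hk2 : k = (2:ℂ) ^ (2 * p - 1 : ℂ) * Complex.Gamma p * Complex.Gamma (1 - σ) := by
    rw [mul_comm (2:ℂ) (p:ℂ)] at *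
    field_simp at h4
    linear_combination h4
  rw [hk a b ha hb, hk2]; ring


lemma holo_int (F : ℂ → ℝ → ℂ) (bound : ℝ → ℝ) (z₀ : ℂ) (r : ℝ) (hr : 0 < r)
    (hm : ∀ z ∈ Metric.ball z₀ r, AEStronglyMeasurable (F z) (volume.restrict (Ioi 1)))
    (hd : ∀ t, 1 < t → ∀ z ∈ Metric.ball z₀ r, DifferentiableAt ℂ (fun z => F z t) z)
    (hb : ∀ t, 1 < t → ∀ z ∈ Metric.ball z₀ r, ‖F z t‖ ≤ bound t)
    (hI : IntegrableOn bound (Ioi 1)) :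
    DifferentiableAt ℂ (fun z => ∫ t in Ioi (1:ℝ), F z t) z₀ := by
  have hz₀ : z₀ ∈ Metric.ball z₀ r := Metric.mem_ball_self hr
  refine (hasDerivAt_integral_of_dominated_loc_of_deriv_le (μ := volume.restrict (Ioi 1)) (𝕜 := ℂ) (F := F)
    (F' := fun z t => deriv (fun z => F z t) z) (s := Metric.ball z₀ (r / 2)) (bound := fun t => bound t / (r / 4))
    (Metric.ball_mem_nhds _ (by positivity)) ?_ ?_ ?_ ?_ (hI.div_const _) ?_).2.differentiableAt
  · filter_upwards [Metric.ball_mem_nhds z₀ hr] with z hz using hm z hz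
  · exact Integrable.mono' hI (hm _ hz₀)
      ((ae_restrict_iff' measurableSet_Ioi).2 (Filter.Eventually.of_forall fun t ht => hb t ht _ hz₀))
  · have hseq : Filter.Tendsto (fun n : ℕ => ((r / 2 / ((n:ℝ) + 1) : ℝ) : ℂ)) Filter.atTop (nhdsWithin 0 {0}ᶜ) := by
      rw [tendsto_nhdsWithin_iff]
      constructor
      · have : Filter.Tendsto (fun n : ℕ => (r / 2 / ((n:ℝ) + 1) : ℝ)) Filter.atTop (nhds 0) := by
          have h := (tendsto_one_div_add_atTop_nhds_zero_nat (𝕜 := ℝ)).const_mul (r / 2)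
          simpa [div_eq_mul_inv] using h
        have h := (Complex.continuous_ofReal.tendsto 0).comp this
        rw [Complex.ofReal_zero] at h
        exact h
      · refine Filter.Eventually.of_forall fun n => ?_
        have : (r / 2 / ((n:ℝ) + 1) : ℝ) ≠ 0 := by positivity
        simpa only [mem_compl_iff, mem_singleton_iff, Complex.ofReal_eq_zero] using this
    refine aestronglyMeasurable_of_tendsto_ae Filter.atTop
      (f := fun (n : ℕ) t => (((r / 2 / ((n:ℝ) + 1) : ℝ) : ℂ))⁻¹ • (F (z₀ + ((r / 2 / ((n:ℝ) + 1) : ℝ) : ℂ)) t - F z₀ t)) ?_ ?_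
    · intro n
      have h1 : 0 < r / 2 / ((n:ℝ) + 1) := by positivity
      have h2 : r / 2 / ((n:ℝ) + 1) ≤ r / 2 := div_le_self (by positivity) (by linarith [Nat.cast_nonneg (α := ℝ) n])
      have hmem : z₀ + ((r / 2 / ((n:ℝ) + 1) : ℝ) : ℂ) ∈ Metric.ball z₀ r := by
        rw [Metric.mem_ball, dist_eq_norm, add_sub_cancel_left, Complex.norm_real, Real.norm_of_nonneg h1.le]
        linarith
      exact ((hm _ hmem).sub (hm _ hz₀)).const_smul ((((r / 2 / ((n:ℝ) + 1) : ℝ) : ℂ))⁻¹)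
    · refine (ae_restrict_iff' measurableSet_Ioi).2 (Filter.Eventually.of_forall fun t ht => ?_)
      have := (hd t ht z₀ hz₀).hasDerivAt
      rw [hasDerivAt_iff_tendsto_slope_zero] at this
      exact this.comp hseq
  · refine (ae_restrict_iff' measurableSet_Ioi).2 (Filter.Eventually.of_forall fun t ht z hz => ?_)
    have hsub : Metric.closedBall z (r / 4) ⊆ Metric.ball z₀ r := by
      intro y hy
      rw [Metric.mem_closedBall] at hy
      rw [Metric.mem_ball] at hz ⊢
      linarith [dist_triangle y z z₀]
    refine Complex.norm_deriv_le_of_forall_mem_sphere_norm_le (by positivity) ?_ ?_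
    · have hdo : DifferentiableOn ℂ (fun z => F z t) (Metric.closedBall z (r / 4)) :=
        fun y hy => (hd t ht y (hsub hy)).differentiableWithinAt
      exact hdo.diffContOnCl_ball subset_rfl
    · exact fun y hy => hb t ht y (hsub (Metric.sphere_subset_closedBall hy))
  · refine (ae_restrict_iff' measurableSet_Ioi).2 (Filter.Eventually.of_forall fun t ht z hz => ?_)
    refine (hd t ht z ?_).hasDerivAt
    exact Metric.ball_subset_ball (by linarith) hz

lemma ident (U : Set ℂ) (hU : IsOpen U) (hc : IsPreconnected U) (f : ℂ → ℂ) (hf : DifferentiableOn ℂ f U)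
    (x₀ : ℝ) (hx : (x₀ : ℂ) ∈ U) (h0 : ∀ᶠ x : ℝ in nhds x₀, f x = 0) (z : ℂ) (hz : z ∈ U) : f z = 0 := by
  refine (hf.analyticOnNhd hU).eqOn_zero_of_preconnected_of_frequently_eq_zero hc hx ?_ hz
  have hseq : Filter.Tendsto (fun x : ℝ => (x : ℂ)) (nhdsWithin x₀ {x₀}ᶜ) (nhdsWithin (x₀:ℂ) {(x₀:ℂ)}ᶜ) := by
    rw [tendsto_nhdsWithin_iff]
    constructor
    · exact (Complex.continuous_ofReal.tendsto x₀).mono_left nhdsWithin_le_nhds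
    · filter_upwards [self_mem_nhdsWithin] with x hx
      simpa using hx
  exact hseq.frequently (h0.filter_mono nhdsWithin_le_nhds).frequently

noncomputable def JA (σ p : ℂ) (a b t : ℝ) : ℂ :=
  vv σ p (ww a b t) / (t:ℂ) ^ 2 - (Real.sinh a * Real.sinh b : ℝ) * v1 σ p (ww a b t) / t

lemma JA_bound (B : ℝ) (hB : 0 ≤ B) (a b : ℝ) (ha : 0 < a) (hb : 0 < b) : ∃ K : ℝ, 0 < K ∧
    ∀ σ p : ℂ, ‖σ‖ ≤ B → ‖p‖ ≤ B → ∀ t, 1 < t → ‖vv σ p (ww a b t)‖ ≤ K * t ^ (σ - 2 * p).re ∧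
      ‖JA σ p a b t‖ ≤ K * t ^ ((σ - 2 * p).re - 2) := by
  obtain ⟨w₀, m, M, hw₀, hm, hM, H⟩ := ww_bounds a b ha hb
  have hmem : a ∈ Ioo (a / 2) (2 * a) := ⟨by linarith, by linarith⟩
  obtain ⟨K, hK, hv⟩ := v_bound B w₀ hB hw₀
  set Q := max 1 (max M m⁻¹) with hQ
  have hQ1 : 1 ≤ Q := le_max_left _ _
  have hQM : M ≤ Q := (le_max_left _ _).trans (le_max_right _ _)
  have hQm : m⁻¹ ≤ Q := (le_max_right _ _).trans (le_max_right _ _)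
  set R := 3 * B + 1
  have hsa := Real.sinh_pos_iff.2 ha
  have hsb := Real.sinh_pos_iff.2 hb
  have hQR : 0 < Q ^ R := by positivity
  refine ⟨K * Q ^ R * (1 + Real.sinh a * Real.sinh b), by positivity, fun σ p hσ hp t ht => ?_⟩
  obtain ⟨h1, h2, h3, -, -⟩ := H a hmem t ht.le
  obtain ⟨b0, b1, -⟩ := hv σ p hσ hp _ h1
  have ht0 : 0 < t := by linarith
  have hw0 : 0 < ww a b t := by linarith
  have hn : ‖σ - 2 * p‖ ≤ 3 * B := by
    have b2 := norm_sub_le σ (2 * p)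
    rw [norm_mul] at b2
    simp at b2; linarith
  have hl : |(σ - 2 * p).re| ≤ 3 * B := (Complex.abs_re_le_norm _).trans hn
  set l := (σ - 2 * p).re
  have key : ∀ r : ℝ, |r| ≤ R → ww a b t ^ r ≤ Q ^ R * t ^ r := by
    intro r hr
    have e : ww a b t = (ww a b t / t) * t := by field_simp
    rw [e, Real.mul_rpow (by positivity) ht0.le]
    gcongr
    have q1 : ww a b t / t ≤ Q := by rw [div_le_iff₀ ht0]; nlinarith
    have q2 : Q⁻¹ ≤ ww a b t / t := by
      have : Q⁻¹ ≤ m := by rw [inv_le_comm₀ (by positivity) hm]; exact hQm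
      rw [le_div_iff₀ ht0]; nlinarith
    rcases le_total 0 r with h | h
    · calc _ ≤ Q ^ r := Real.rpow_le_rpow (by positivity) q1 h
        _ ≤ Q ^ R := Real.rpow_le_rpow_of_exponent_le hQ1 ((le_abs_self _).trans hr)
    · calc _ ≤ (Q⁻¹) ^ r := Real.rpow_le_rpow_of_nonpos (by positivity) q2 h
        _ = Q ^ (-r) := by rw [Real.inv_rpow (by positivity), Real.rpow_neg (by positivity)]
        _ ≤ Q ^ R := Real.rpow_le_rpow_of_exponent_le hQ1 ((neg_le_abs _).trans hr)
  have k0 := b0.trans (mul_le_mul_of_nonneg_left (key l (by linarith)) hK.le)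
  have k1 := b1.trans (mul_le_mul_of_nonneg_left (key (l - 1) (by
    rw [abs_le] at hl ⊢; constructor <;> linarith)) hK.le)
  have hS : 0 < Real.sinh a * Real.sinh b := by positivity
  constructor
  · refine k0.trans ?_
    have : 0 < K * Q ^ R * t ^ l := by positivity
    nlinarith
  · unfold JA
    refine (norm_sub_le _ _).trans ?_
    rw [norm_div, norm_div, norm_mul, norm_pow, Complex.norm_real, Complex.norm_real, Real.norm_of_nonneg ht0.le,
      Real.norm_of_nonneg hS.le]
    have e1 : t ^ l = t ^ (l - 2) * t ^ 2 := by
      rw [Real.rpow_sub ht0]; norm_num; field_simp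
    have e2 : t ^ (l - 1) = t ^ (l - 2) * t := by
      rw [show l - 1 = (l - 2) + 1 by ring, Real.rpow_add_one ht0.ne']
    rw [e1] at k0
    rw [e2] at k1
    calc _ ≤ (K * (Q ^ R * (t ^ (l - 2) * t ^ 2))) / t ^ 2 + Real.sinh a * Real.sinh b * (K * (Q ^ R * (t ^ (l - 2) * t))) / t := by
          gcongr
      _ = _ := by field_simp

lemma cont_JA (σ p : ℂ) (a b : ℝ) (ha : 0 < a) (hb : 0 < b) : ContinuousOn (JA σ p a b) (Ioi 1) := by
  unfold JA
  have h1 := cont_comp_ww _ (cont_v1 σ p) a b ha hb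
  have h2 := cont_comp_ww _ (cont_vv σ p) a b ha hb
  have hne : ∀ t ∈ Ioi (1:ℝ), (t:ℂ) ≠ 0 := fun t ht => by
    have : (1:ℝ) < t := ht
    exact_mod_cast (show t ≠ 0 by linarith)
  refine (h2.div (by fun_prop) fun t ht => pow_ne_zero 2 (hne t ht)).sub ((continuousOn_const.mul h1).div (by fun_prop) hne)

noncomputable def Phi (σ p : ℂ) (a b : ℝ) : ℂ := ∫ t in Ioi (1:ℝ), JA σ p a b t * om p t

lemma JA_om_bound (K t s r s1 r1 : ℝ) (σ p : ℂ) (a b : ℝ) (hK : 0 < K) (ht : 1 < t) (hs : s = σ.re) (hr : r = p.re)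
    (h : ‖JA σ p a b t‖ ≤ K * t ^ ((σ - 2 * p).re - 2)) (hs1 : s ≤ s1) (hr1 : r1 ≤ r) :
    ‖JA σ p a b t * om p t‖ ≤ K * (t ^ (s1 - 2 - 2 * r1) * (t ^ 2 - 1) ^ r1) := by
  have ht0 : 0 < t := by linarith
  have hpos := sq_sub_pos ht
  rw [norm_mul, om_norm _ _ ht, ← hr]
  have e0 : (σ - 2 * p).re - 2 = (s - 2) + (-2) * r := by simp [hs, hr]; ring
  rw [e0] at h
  have aux : ∀ x : ℝ, t ^ (-2 * x) * (t ^ 2 - 1) ^ x = ((t ^ 2 - 1) / t ^ 2) ^ x := by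
    intro x
    rw [Real.div_rpow hpos.le (by positivity), show (t ^ 2) ^ x = t ^ (2 * x) by rw [Real.rpow_mul ht0.le]; norm_num,
      div_eq_mul_inv, ← Real.rpow_neg ht0.le]
    rw [show -2 * x = -(2 * x) by ring]; ring
  calc _ ≤ K * t ^ (s - 2 + -2 * r) * (t ^ 2 - 1) ^ r := by gcongr
    _ = K * (t ^ (s - 2) * ((t ^ 2 - 1) / t ^ 2) ^ r) := by rw [Real.rpow_add ht0, ← aux r]; ring
    _ ≤ K * (t ^ (s1 - 2) * ((t ^ 2 - 1) / t ^ 2) ^ r1) := by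
      have d1 : t ^ (s - 2) ≤ t ^ (s1 - 2) := Real.rpow_le_rpow_of_exponent_le ht.le (by linarith)
      have d2 : ((t ^ 2 - 1) / t ^ 2) ^ r ≤ ((t ^ 2 - 1) / t ^ 2) ^ r1 :=
        Real.rpow_le_rpow_of_exponent_ge (by positivity) (by rw [div_le_one (by positivity)]; linarith) hr1
      gcongr
    _ = _ := by rw [← aux r1, show s1 - 2 - 2 * r1 = (s1 - 2) + (-2 * r1) by ring, Real.rpow_add ht0]; ring

lemma JA_integrable (σ p : ℂ) (hσ : σ.re < 1) (hp : -1 < p.re) (a b : ℝ) (ha : 0 < a) (hb : 0 < b) :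
    IntegrableOn (fun t => JA σ p a b t * om p t) (Ioi 1) := by
  obtain ⟨K, hK, H⟩ := JA_bound (max ‖σ‖ ‖p‖) (by positivity) a b ha hb
  have hI := (integrable_pw (σ.re - 2 - 2 * p.re) p.re hp (by linarith)).const_mul K
  refine Integrable.mono' hI (((cont_JA σ p a b ha hb).mul (cont_om p)).aestronglyMeasurable measurableSet_Ioi) ?_
  refine (ae_restrict_iff' measurableSet_Ioi).2 (Filter.Eventually.of_forall fun t (ht : 1 < t) => ?_)
  exact JA_om_bound K t _ _ _ _ σ p a b hK ht rfl rfl (H σ p (le_max_left _ _) (le_max_right _ _) t ht).2 le_rfl le_rfl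

lemma Phi_differentiable (s r : ℂ → ℂ) (hs : Differentiable ℂ s) (hr : Differentiable ℂ r) (z₀ : ℂ)
    (h1 : (s z₀).re < 1) (h2 : -1 < (r z₀).re) (a b : ℝ) (ha : 0 < a) (hb : 0 < b) :
    DifferentiableAt ℂ (fun z => Phi (s z) (r z) a b) z₀ := by
  set ε := min ((1 - (s z₀).re) / 2) ((1 + (r z₀).re) / 2) with hε
  have hε0 : 0 < ε := lt_min (by linarith) (by linarith)
  have hε1 : ε ≤ (1 - (s z₀).re) / 2 := min_le_left _ _
  have hε2 : ε ≤ (1 + (r z₀).re) / 2 := min_le_right _ _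
  obtain ⟨δ1, hδ1, H1⟩ := Metric.continuousAt_iff.1 (hs z₀).continuousAt ε hε0
  obtain ⟨δ2, hδ2, H2⟩ := Metric.continuousAt_iff.1 (hr z₀).continuousAt ε hε0
  set B := max (‖s z₀‖ + ε) (‖r z₀‖ + ε)
  have hB : 0 ≤ B := le_max_of_le_left (by positivity)
  obtain ⟨K, hK, H⟩ := JA_bound B hB a b ha hb
  have hI := (integrable_pw ((s z₀).re + ε - 2 - 2 * ((r z₀).re - ε)) ((r z₀).re - ε) (by linarith) (by linarith)).const_mul K
  have aux : ∀ f : ℂ → ℂ, ∀ z, dist (f z) (f z₀) < ε → ‖f z‖ ≤ ‖f z₀‖ + ε ∧ (f z).re ≤ (f z₀).re + ε ∧ (f z₀).re - ε ≤ (f z).re := by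
    intro f z hz
    rw [dist_eq_norm] at hz
    have := (Complex.abs_re_le_norm (f z - f z₀)).trans hz.le
    rw [Complex.sub_re, abs_le] at this
    have h3 := norm_sub_norm_le (f z) (f z₀)
    refine ⟨by linarith, by linarith [this.2], by linarith [this.1]⟩
  refine holo_int (fun z t => JA (s z) (r z) a b t * om (r z) t) _ z₀ (min δ1 δ2) (lt_min hδ1 hδ2) ?_ ?_ ?_ hI
  · exact fun z _ => ((cont_JA _ _ a b ha hb).mul (cont_om _)).aestronglyMeasurable measurableSet_Ioi
  · intro t ht z _
    have hc := Real.arcosh_pos (ww_gt_one a b t ha hb ht.le)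
    have d0 := uu_differentiable s r hs hr 0 _ hc z
    have d1 := uu_differentiable s r hs hr 1 _ hc z
    have hne : ((t ^ 2 - 1 : ℝ) : ℂ) ≠ 0 := by exact_mod_cast (sq_sub_pos ht).ne'
    have d2 : DifferentiableAt ℂ (fun z => om (r z) t) z := by
      unfold om
      exact (hr z).const_cpow (Or.inl hne)
    unfold JA vv v1
    exact ((d0.div_const _).sub (((d1.div_const _).const_mul _).div_const _)).mul d2
  · intro t ht z hz
    rw [Metric.mem_ball, lt_min_iff] at hz
    obtain ⟨n1, n2, -⟩ := aux s z (H1 hz.1)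
    obtain ⟨m1, -, m3⟩ := aux r z (H2 hz.2)
    exact JA_om_bound K t _ _ _ _ (s z) (r z) a b hK ht rfl rfl
      (H _ _ (n1.trans (le_max_left _ _)) (m1.trans (le_max_right _ _)) t ht).2 n2 m3

lemma Phi_ibp (σ p : ℂ) (hσ : σ.re < 1) (hp : -1 < p.re) (a b : ℝ) (ha : 0 < a) (hb : 0 < b)
    (hint : IntegrableOn (fun t => vv σ p (ww a b t) * om (p - 1) t) (Ioi 1))
    (h0 : Filter.Tendsto (fun t => vv σ p (ww a b t) * om p t) (nhdsWithin 1 (Ioi 1)) (nhds 0)) :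
    Phi σ p a b = 2 * p * U0 σ p a b := by
  have hJ := JA_integrable σ p hσ hp a b ha hb
  have hz : ∫ t in Ioi (1:ℝ), (2 * p * (vv σ p (ww a b t) * om (p - 1) t) - JA σ p a b t * om p t) = 0 := by
    refine ftc0 (fun t => (vv σ p (ww a b t) * om p t) * ((t⁻¹ : ℝ) : ℂ)) _ ?_ ((hint.const_mul _).sub hJ) ?_ ?_
    · intro t ht
      have hw := ww_gt_one a b t ha hb ht.le
      have ht0 : t ≠ 0 := by linarith
      have ht0' : (t:ℂ) ≠ 0 := by exact_mod_cast ht0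
      have h1 := ((vv_hasDerivAt σ p _ hw).scomp t (ww_hasDerivAt_t a b t)).mul (om_hasDerivAt p t ht)
      refine (h1.mul (hasDerivAt_inv ht0).ofReal_comp).congr_deriv ?_
      simp only [JA, Function.comp, Complex.real_smul, Pi.mul_apply]
      simp only [Complex.ofReal_mul, Complex.ofReal_neg, Complex.ofReal_inv, Complex.ofReal_pow]
      field_simp
      ring
    · have h1 : Filter.Tendsto (fun t : ℝ => ((t⁻¹ : ℝ) : ℂ)) (nhdsWithin 1 (Ioi 1)) (nhds ((1⁻¹ : ℝ) : ℂ)) := by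
        refine (Complex.continuous_ofReal.tendsto _).comp ?_
        exact (continuousAt_inv₀ (one_ne_zero)).tendsto.mono_left nhdsWithin_le_nhds
      simpa using h0.mul h1
    · obtain ⟨K, hK, H⟩ := JA_bound (max ‖σ‖ ‖p‖) (by positivity) a b ha hb
      have h3 : Filter.Tendsto (fun t : ℝ => K * 2 ^ |p.re| * t ^ (-(1 - σ.re))) Filter.atTop (nhds 0) := by
        simpa using (tendsto_rpow_neg_atTop (show 0 < 1 - σ.re by linarith)).const_mul (K * 2 ^ |p.re|)
      refine squeeze_zero_norm' ?_ h3
      filter_upwards [Filter.eventually_gt_atTop (2:ℝ)] with t ht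
      have ht1 : 1 < t := by linarith
      have ht0 : 0 < t := by linarith
      have hpos := sq_sub_pos ht1
      rw [norm_mul, norm_mul, om_norm _ _ ht1, Complex.norm_real, Real.norm_of_nonneg (by positivity)]
      have k0 := (H σ p (le_max_left _ _) (le_max_right _ _) t ht1).1
      have k1 : (t ^ 2 - 1) ^ p.re ≤ 2 ^ |p.re| * t ^ (2 * p.re) := by
        have e1 : t ^ 2 - 1 = ((t ^ 2 - 1) / t ^ 2) * t ^ 2 := by field_simp
        have e2 : (t ^ 2) ^ p.re = t ^ (2 * p.re) := by rw [Real.rpow_mul ht0.le]; norm_num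
        rw [e1, Real.mul_rpow (by positivity) (by positivity), e2]
        gcongr
        have b1 : (t ^ 2 - 1) / t ^ 2 ≤ 1 := by rw [div_le_one (by positivity)]; linarith
        have b2 : 1 / 2 ≤ (t ^ 2 - 1) / t ^ 2 := by
          rw [div_le_div_iff₀ (by norm_num) (by positivity)]; nlinarith
        calc _ ≤ ((t ^ 2 - 1) / t ^ 2) ^ (- |p.re|) :=
              Real.rpow_le_rpow_of_exponent_ge (by positivity) b1 (neg_abs_le _)
          _ ≤ (1 / 2) ^ (- |p.re|) :=
              Real.rpow_le_rpow_of_nonpos (by norm_num) b2 (by simp)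
          _ = 2 ^ |p.re| := by rw [one_div, Real.inv_rpow (by norm_num), Real.rpow_neg (by norm_num), inv_inv]
      calc _ ≤ (K * t ^ (σ - 2 * p).re) * (2 ^ |p.re| * t ^ (2 * p.re)) * t⁻¹ := by gcongr
        _ = K * 2 ^ |p.re| * (t ^ (σ - 2 * p).re * t ^ (2 * p.re) * t ^ (-1 : ℝ)) := by
          rw [Real.rpow_neg_one]; ring
        _ = _ := by
          rw [← Real.rpow_add ht0, ← Real.rpow_add ht0]; congr 2; simp; ring
  rw [integral_sub (hint.const_mul _) hJ, integral_const_mul] at hz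
  unfold Phi U0
  exact (sub_eq_zero.1 hz).symm

lemma Phi_base (σ p : ℝ) (hσ : σ < 0) (hp : 0 < p) (a b : ℝ) (ha : 0 < a) (hb : 0 < b) :
    Phi σ p a b = (2:ℂ) ^ (2 * p : ℂ) * Complex.Gamma (p + 1) * Complex.Gamma (1 - σ) * (uu σ p 0 a * uu σ p 0 b) := by
  have hp' : 0 < (p:ℂ).re := by simpa
  have hl' : ((σ:ℂ) - 2 * p).re < 0 := by simp; linarith
  have hσ' : (σ:ℂ).re < 1 := by simp; linarith
  obtain ⟨K, hK, H⟩ := g_bounds σ p a b ha hb hl'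
  have hmem : a ∈ Ioo (a / 2) (2 * a) := ⟨by linarith, by linarith⟩
  have i0 := integrable_of_bd σ p hp' hσ' K _ (cont_comp_ww _ (cont_vv σ p) a b ha hb) (fun t ht => (H a hmem t ht).1)
  have hc : Filter.Tendsto (fun t => vv σ p (ww a b t)) (nhdsWithin 1 (Ioi 1)) (nhds (vv σ p (ww a b 1))) := by
    have : ContinuousAt (fun t => vv σ p (ww a b t)) 1 :=
      ContinuousAt.comp (f := ww a b) (vv_hasDerivAt σ p _ (ww_gt_one a b 1 ha hb le_rfl)).continuousAt (cont_ww a b).continuousAt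
    exact this.tendsto.mono_left nhdsWithin_le_nhds
  rw [Phi_ibp σ p hσ' (by linarith) a b ha hb i0 (by simpa using hc.mul (om_tendsto_one p hp')),
    U0_formula σ p hσ hp a b ha hb, Complex.Gamma_add_one _ (by exact_mod_cast hp.ne'),
    Complex.cpow_sub _ _ two_ne_zero, Complex.cpow_one]
  field_simp

lemma Phi_eq (σ p : ℂ) (hσ : σ.re < 1) (hp : -1 < p.re) (a b : ℝ) (ha : 0 < a) (hb : 0 < b) :
    Phi σ p a b = (2:ℂ) ^ (2 * p) * Complex.Gamma (p + 1) * Complex.Gamma (1 - σ) * (uu σ p 0 a * uu σ p 0 b) := by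
  have hUs : IsOpen {z : ℂ | z.re < 1} := isOpen_lt Complex.continuous_re continuous_const
  have hUp : IsOpen {z : ℂ | -1 < z.re} := isOpen_lt continuous_const Complex.continuous_re
  have hGs : ∀ z : ℂ, z.re < 1 → DifferentiableAt ℂ (fun z => Complex.Gamma (1 - z)) z := by
    intro z hz
    refine DifferentiableAt.comp z (f := fun z => 1 - z) (Complex.differentiableAt_Gamma _ fun m h => ?_) (by fun_prop)
    have := congrArg Complex.re h
    simp at this
    linarith [Nat.cast_nonneg (α := ℝ) m]
  have hGp : ∀ z : ℂ, -1 < z.re → DifferentiableAt ℂ (fun z => Complex.Gamma (z + 1)) z := by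
    intro z hz
    refine DifferentiableAt.comp z (f := fun z => z + 1) (Complex.differentiableAt_Gamma _ fun m h => ?_) (by fun_prop)
    have := congrArg Complex.re h
    simp at this
    linarith [Nat.cast_nonneg (α := ℝ) m]
  have step1 : ∀ q : ℝ, 0 < q → ∀ s : ℂ, s.re < 1 →
      Phi s q a b - (2:ℂ) ^ (2 * q : ℂ) * Complex.Gamma (q + 1) * Complex.Gamma (1 - s) * (uu s q 0 a * uu s q 0 b) = 0 := by
    intro q hq s hs
    refine ident {z : ℂ | z.re < 1} hUs (convex_halfSpace_re_lt 1).isPreconnected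
      (fun s => Phi s q a b - (2:ℂ) ^ (2 * q : ℂ) * Complex.Gamma (q + 1) * Complex.Gamma (1 - s) * (uu s q 0 a * uu s q 0 b))
      ?_ (-1) (by simp) ?_ s hs
    · intro z hz
      have d1 := Phi_differentiable (fun z => z) (fun _ => (q:ℂ)) differentiable_id (differentiable_const _) z hz (by simp; linarith) a b ha hb
      have d2 := uu_differentiable (fun z => z) (fun _ => (q:ℂ)) differentiable_id (differentiable_const _) 0 a ha z
      have d3 := uu_differentiable (fun z => z) (fun _ => (q:ℂ)) differentiable_id (differentiable_const _) 0 b hb z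
      exact (d1.sub (((hGs z hz).const_mul _).mul (d2.mul d3))).differentiableWithinAt
    · filter_upwards [Iio_mem_nhds (show (-1:ℝ) < 0 by norm_num)] with x hx
      exact sub_eq_zero.2 (Phi_base x q hx hq a b ha hb)
  refine sub_eq_zero.1 (ident {z : ℂ | -1 < z.re} hUp (convex_halfSpace_re_gt (-1)).isPreconnected
      (fun p => Phi σ p a b - (2:ℂ) ^ (2 * p : ℂ) * Complex.Gamma (p + 1) * Complex.Gamma (1 - σ) * (uu σ p 0 a * uu σ p 0 b))
      ?_ 1 (by simp) ?_ p hp)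
  · intro z hz
    have d1 := Phi_differentiable (fun _ => σ) (fun z => z) (differentiable_const _) differentiable_id z hσ hz a b ha hb
    have d2 := uu_differentiable (fun _ => σ) (fun z => z) (differentiable_const _) differentiable_id 0 a ha z
    have d3 := uu_differentiable (fun _ => σ) (fun z => z) (differentiable_const _) differentiable_id 0 b hb z
    have d4 : DifferentiableAt ℂ (fun p : ℂ => (2:ℂ) ^ (2 * p : ℂ)) z :=
      DifferentiableAt.const_cpow (by fun_prop) (Or.inl two_ne_zero)
    exact (d1.sub (((d4.mul (hGp z hz)).mul_const _).mul (d2.mul d3))).differentiableWithinAt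
  · filter_upwards [Ioi_mem_nhds (show (0:ℝ) < 1 by norm_num)] with x hx
    exact step1 x hx σ hσ


lemma lim_zero_of_int (h : ℝ → ℂ) (q L : ℂ) (hq : q.re ≤ -1)
    (hl : Filter.Tendsto h (nhdsWithin 1 (Ioi 1)) (nhds L))
    (hint : IntegrableOn (fun t => h t * om q t) (Ioi 1)) : L = 0 := by
  by_contra hL
  refine not_integrableOn_of_tendsto_norm_atTop_of_deriv_isBigO_filter (f := fun t : ℝ => Real.log (t - 1))
    (nhdsWithin (1:ℝ) (Ioi 1)) self_mem_nhdsWithin ?_ ?_ ?_ hint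
  · filter_upwards [self_mem_nhdsWithin] with t ht
    have ht' : (1:ℝ) < t := ht
    exact DifferentiableAt.log (by fun_prop) (by linarith)
  · have h1 : Filter.Tendsto (fun t : ℝ => t - 1) (nhdsWithin 1 (Ioi 1)) (nhdsWithin 0 {0}ᶜ) := by
      rw [tendsto_nhdsWithin_iff]
      constructor
      · have : Filter.Tendsto (fun t : ℝ => t - 1) (nhds 1) (nhds (1 - 1)) :=
          (continuous_id.sub continuous_const).tendsto 1
        rw [sub_self] at this
        exact this.mono_left nhdsWithin_le_nhds
      · filter_upwards [self_mem_nhdsWithin] with t ht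
        have ht' : (1:ℝ) < t := ht
        simp only [mem_compl_iff, mem_singleton_iff]
        linarith
    exact Filter.tendsto_abs_atBot_atTop.comp (Real.tendsto_log_nhdsNE_zero.comp h1)
  · refine Asymptotics.IsBigO.of_bound (6 / ‖L‖) ?_
    have hLpos : 0 < ‖L‖ := norm_pos_iff.2 hL
    have h2 := (hl.norm).eventually (lt_mem_nhds (half_lt_self hLpos))
    filter_upwards [self_mem_nhdsWithin, h2, mem_nhdsWithin_of_mem_nhds (Iio_mem_nhds (show (1:ℝ) < 5/4 by norm_num))]
      with t ht h3 h4
    have ht' : (1:ℝ) < t := ht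
    have h4' : t < 5/4 := h4
    have hd : deriv (fun t : ℝ => Real.log (t - 1)) t = (t - 1)⁻¹ := by
      have := ((hasDerivAt_id t).sub_const 1).log (by simp; linarith)
      simpa using this.deriv
    rw [hd, norm_mul, om_norm _ _ ht', Real.norm_of_nonneg (by rw [inv_nonneg]; linarith)]
    have hpos := sq_sub_pos ht'
    have h5 : (t ^ 2 - 1)⁻¹ ≤ (t ^ 2 - 1) ^ q.re := by
      rw [← Real.rpow_neg_one]
      exact Real.rpow_le_rpow_of_exponent_ge hpos (by nlinarith) hq
    have h6 : (t - 1)⁻¹ ≤ 3 * (t ^ 2 - 1)⁻¹ := by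
      rw [← div_eq_mul_inv, inv_eq_one_div, div_le_div_iff₀ (by linarith) hpos]
      nlinarith
    have h7 : 3 ≤ 6 / ‖L‖ * ‖h t‖ := by
      rw [div_mul_eq_mul_div, le_div_iff₀ hLpos]; linarith
    calc (t - 1)⁻¹ ≤ 3 * (t ^ 2 - 1)⁻¹ := h6
      _ ≤ 6 / ‖L‖ * ‖h t‖ * (t ^ 2 - 1) ^ q.re := by
        apply mul_le_mul h7 h5 (by positivity) (by positivity)
      _ = _ := by ring

lemma uu_unique (σ p : ℂ) (c₀ : ℝ) (hc₀ : 0 < c₀) (h0 : uu σ p 0 c₀ = 0) (h1 : uu σ p 1 c₀ = 0)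
    (c : ℝ) (hc : 0 < c) : uu σ p 0 c = 0 := by
  set m := min c c₀ / 2 with hm
  have hmin : 0 < min c c₀ := lt_min hc hc₀
  have hm0 : 0 < m := by positivity
  set M := c + c₀ + 1 with hM
  have hcm : c ∈ Ioo m M := ⟨by have := min_le_left c c₀; linarith, by linarith⟩
  have hc0m : c₀ ∈ Ioo m M := ⟨by have := min_le_right c c₀; linarith, by linarith⟩
  set B : ℝ := ‖2 * p‖ * (Real.cosh M / Real.sinh m) + ‖(σ - 2 * p) * σ‖ + 1 with hB
  have hsm : 0 < Real.sinh m := Real.sinh_pos_iff.2 hm0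
  have hB0 : 0 ≤ B := by have := Real.cosh_pos M; positivity
  have key := ODE_solution_unique_of_mem_Ioo (E := ℂ × ℂ) (a := m) (b := M) (t₀ := c₀)
    (v := fun t y => (y.2, (σ - 2 * p) * σ * y.1 - 2 * p * (Real.cosh t / Real.sinh t : ℝ) * y.2))
    (s := fun _ => univ) (K := ⟨B, hB0⟩) (f := fun t => (uu σ p 0 t, uu σ p 1 t)) (g := fun _ => 0)
    ?_ hc0m ?_ ?_ (by simp [h0, h1])
  · have := key hcm
    simpa using congrArg Prod.fst this
  · intro t ht
    refine LipschitzOnWith.of_dist_le_mul fun x _ y _ => ?_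
    have htpos : 0 < t := hm0.trans ht.1
    have hst : 0 < Real.sinh t := Real.sinh_pos_iff.2 htpos
    have hq : Real.cosh t / Real.sinh t ≤ Real.cosh M / Real.sinh m := by
      apply div_le_div₀ (Real.cosh_pos _).le _ hsm (Real.sinh_le_sinh.2 ht.1.le)
      exact Real.cosh_le_cosh.2 (by rw [abs_of_pos htpos, abs_of_pos (htpos.trans ht.2)]; exact ht.2.le)
    have hq0 : 0 ≤ Real.cosh t / Real.sinh t := div_nonneg (Real.cosh_pos _).le hst.le
    have e1 : ‖x.1 - y.1‖ ≤ dist x y := by rw [dist_eq_norm]; exact norm_fst_le (x - y)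
    have e2 : ‖x.2 - y.2‖ ≤ dist x y := by rw [dist_eq_norm]; exact norm_snd_le (x - y)
    have hd : 0 ≤ dist x y := dist_nonneg
    change dist _ _ ≤ B * dist x y
    rw [dist_eq_norm (E := ℂ × ℂ), Prod.norm_def]
    refine max_le ?_ ?_
    · refine e2.trans ?_
      refine le_mul_of_one_le_left hd ?_
      have : 0 ≤ ‖2 * p‖ * (Real.cosh M / Real.sinh m) + ‖(σ - 2 * p) * σ‖ := by
        have := Real.cosh_pos M; positivity
      linarith
    · have : ((σ - 2 * p) * σ * x.1 - 2 * p * (Real.cosh t / Real.sinh t : ℝ) * x.2) -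
          ((σ - 2 * p) * σ * y.1 - 2 * p * (Real.cosh t / Real.sinh t : ℝ) * y.2) =
          (σ - 2 * p) * σ * (x.1 - y.1) - 2 * p * (Real.cosh t / Real.sinh t : ℝ) * (x.2 - y.2) := by ring
      change ‖((σ - 2 * p) * σ * x.1 - 2 * p * (Real.cosh t / Real.sinh t : ℝ) * x.2) -
          ((σ - 2 * p) * σ * y.1 - 2 * p * (Real.cosh t / Real.sinh t : ℝ) * y.2)‖ ≤ _
      rw [this]
      refine (norm_sub_le _ _).trans ?_
      rw [norm_mul, norm_mul (2 * p * _), norm_mul (2 * p), Complex.norm_real, Real.norm_of_nonneg hq0]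
      have f1 : ‖(σ - 2 * p) * σ‖ * ‖x.1 - y.1‖ ≤ ‖(σ - 2 * p) * σ‖ * dist x y := by gcongr
      have f2 : ‖2 * p‖ * (Real.cosh t / Real.sinh t) * ‖x.2 - y.2‖ ≤
        ‖2 * p‖ * (Real.cosh M / Real.sinh m) * dist x y := by
        apply mul_le_mul _ e2 (norm_nonneg _)
        · have := Real.cosh_pos M; positivity
        · gcongr
      rw [hB]; nlinarith
  · intro t ht
    have htpos : 0 < t := hm0.trans ht.1
    refine ⟨?_, mem_univ _⟩
    refine ((uu_hasDerivAt σ p 0 t htpos).prodMk (uu_hasDerivAt σ p 1 t htpos)).congr_deriv ?_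
    have hst : (Real.sinh t : ℂ) ≠ 0 := by exact_mod_cast (Real.sinh_pos_iff.2 htpos).ne'
    have ode := uu_ode σ p t htpos
    refine Prod.ext rfl ?_
    change uu σ p 2 t = _
    rw [Complex.ofReal_div]
    field_simp
    linear_combination ode
  · intro t ht
    refine ⟨(hasDerivAt_const t _).congr_deriv ?_, mem_univ _⟩
    simp only [Prod.fst_zero, Prod.snd_zero, mul_zero, sub_zero]
    rfl

lemma ww_one (a b : ℝ) : ww a b 1 = Real.cosh (a + b) := by
  unfold ww; rw [Real.cosh_add]; ring

lemma g_hasDerivAt (σ p : ℂ) (a b : ℝ) (ha : 0 < a) (hb : 0 < b) :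
    HasDerivAt (fun t => vv σ p (ww a b t)) (((Real.sinh a * Real.sinh b : ℝ) : ℂ) * v1 σ p (ww a b 1)) 1 := by
  have h := (vv_hasDerivAt σ p (ww a b 1) (ww_gt_one a b 1 ha hb le_rfl)).scomp (1:ℝ) (ww_hasDerivAt_t a b 1)
  exact h.congr_deriv (by rw [Complex.real_smul])

lemma quot_lim (g : ℝ → ℂ) (d : ℂ) (hg : HasDerivAt g d 1) (h0 : g 1 = 0) :
    Filter.Tendsto (fun t => g t / ((t ^ 2 - 1 : ℝ) : ℂ)) (nhdsWithin 1 (Ioi 1)) (nhds (d / 2)) := by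
  have h1 := hasDerivAt_iff_tendsto_slope.1 hg
  have h2 := h1.mono_left (nhdsWithin_mono (1:ℝ) (show Ioi (1:ℝ) ⊆ {1}ᶜ from fun x (hx : 1 < x) => hx.ne'))
  have h3 : Filter.Tendsto (fun t : ℝ => ((t + 1 : ℝ) : ℂ)) (nhdsWithin 1 (Ioi 1)) (nhds 2) := by
    have : Filter.Tendsto (fun t : ℝ => ((t + 1 : ℝ) : ℂ)) (nhds 1) (nhds ((1 + 1 : ℝ) : ℂ)) :=
      (show Continuous (fun t : ℝ => ((t + 1 : ℝ) : ℂ)) by fun_prop).tendsto 1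
    have e : ((1 + 1 : ℝ) : ℂ) = 2 := by push_cast; norm_num
    rw [e] at this
    exact this.mono_left nhdsWithin_le_nhds
  refine (h2.div h3 two_ne_zero).congr' ?_
  filter_upwards [self_mem_nhdsWithin] with t ht
  have ht' : (1:ℝ) < t := ht
  have n1 : ((t:ℂ) - 1) ≠ 0 := by
    have : t - 1 ≠ 0 := by linarith
    exact_mod_cast this
  have n2 : ((t:ℂ) + 1) ≠ 0 := by
    have : t + 1 ≠ 0 := by linarith
    exact_mod_cast this
  simp only [Pi.div_apply, slope, vsub_eq_sub, h0, sub_zero, Complex.real_smul]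
  have n3 : ((t:ℂ) ^ 2 - 1) ≠ 0 := by
    have := (sq_sub_pos ht').ne'
    exact_mod_cast this
  push_cast
  field_simp
  ring

lemma core (σ p : ℂ) (hσ : σ.re < 1) (hp : ∀ n : ℕ, 1 - p ≠ -(n:ℂ)) (a b : ℝ) (ha : 0 < a) (hb : 0 < b)
    (hint : IntegrableOn (fun t => vv σ p (ww a b t) * om (p - 1) t) (Ioi 1)) :
    Complex.sin (Real.pi * p) * Complex.Gamma (1 - p) * U0 σ p a b =
      Real.pi * (2:ℂ) ^ (2 * p - 1) * Complex.Gamma (1 - σ) * (uu σ p 0 a * uu σ p 0 b) := by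
  have hder := g_hasDerivAt σ p a b ha hb
  have hlim : Filter.Tendsto (fun t => vv σ p (ww a b t)) (nhdsWithin 1 (Ioi 1)) (nhds (vv σ p (ww a b 1))) :=
    hder.continuousAt.tendsto.mono_left nhdsWithin_le_nhds
  have hg0 : p.re ≤ 0 → vv σ p (ww a b 1) = 0 := fun h =>
    lim_zero_of_int _ (p - 1) _ (by simp; linarith) hlim hint
  have hresc : ∀ t, 1 < t → vv σ p (ww a b t) / ((t ^ 2 - 1 : ℝ) : ℂ) * om p t = vv σ p (ww a b t) * om (p - 1) t := by
    intro t ht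
    have : ((t ^ 2 - 1 : ℝ) : ℂ) ≠ 0 := by exact_mod_cast (sq_sub_pos ht).ne'
    rw [om_succ p t ht]
    field_simp
  rcases lt_or_ge (-1) p.re with hp1 | hp1
  · have h0 : Filter.Tendsto (fun t => vv σ p (ww a b t) * om p t) (nhdsWithin 1 (Ioi 1)) (nhds 0) := by
      rcases lt_or_ge 0 p.re with h | h
      · simpa using hlim.mul (om_tendsto_one p h)
      · have h3 := (quot_lim _ _ hder (hg0 h)).mul (om_tendsto_one (p + 1) (by simp; linarith))
        rw [mul_zero] at h3
        refine h3.congr' ?_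
        filter_upwards [self_mem_nhdsWithin] with t ht
        have ht' : (1:ℝ) < t := ht
        have : ((t ^ 2 - 1 : ℝ) : ℂ) ≠ 0 := by exact_mod_cast (sq_sub_pos ht').ne'
        rw [om_succ (p + 1) t ht', add_sub_cancel_right]
        field_simp
    have hA := Phi_ibp σ p hσ hp1 a b ha hb hint h0
    rw [Phi_eq σ p hσ hp1 a b ha hb] at hA
    rcases eq_or_ne p 0 with h | h
    · subst h
      simp at hA
      have hG : Complex.Gamma (1 - σ) ≠ 0 := Complex.Gamma_ne_zero_of_re_pos (by simp; linarith)
      rcases hA with hA | hA | hA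
      · exact absurd hA hG
      · rw [hA]; simp
      · rw [hA]; simp
    · have hG1 : Complex.Gamma (1 - p) ≠ 0 := Complex.Gamma_ne_zero hp
      have hG2 : Complex.Gamma p ≠ 0 := by
        refine Complex.Gamma_ne_zero fun m hm => ?_
        rcases m with _ | m
        · simp at hm; exact h hm
        · rw [hm] at hp1
          simp at hp1
          linarith [Nat.cast_nonneg (α := ℝ) m]
      have hR := Complex.Gamma_mul_Gamma_one_sub p
      have hs : Complex.sin (Real.pi * p) ≠ 0 := by
        intro hs
        rw [hs, div_zero] at hR
        exact mul_ne_zero hG2 hG1 hR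
      rw [eq_div_iff hs] at hR
      rw [Complex.Gamma_add_one p h] at hA
      have h2p : (2:ℂ) ^ (2 * p) = 2 * (2:ℂ) ^ (2 * p - 1) := by
        rw [Complex.cpow_sub _ _ two_ne_zero, Complex.cpow_one]; ring
      rw [h2p] at hA
      have hU : U0 σ p a b = (2:ℂ) ^ (2 * p - 1) * Complex.Gamma p * Complex.Gamma (1 - σ) * (uu σ p 0 a * uu σ p 0 b) := by
        apply mul_left_cancel₀ (mul_ne_zero two_ne_zero h)
        linear_combination -hA
      rw [hU]
      linear_combination ((2:ℂ) ^ (2 * p - 1) * Complex.Gamma (1 - σ) * (uu σ p 0 a * uu σ p 0 b)) * hR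
  · have hz := hg0 (by linarith)
    have hd := lim_zero_of_int _ p _ hp1 (quot_lim _ _ hder hz)
      (hint.congr_fun (fun t ht => (hresc t ht).symm) measurableSet_Ioi)
    have hS : 0 < Real.sinh a * Real.sinh b := mul_pos (Real.sinh_pos_iff.2 ha) (Real.sinh_pos_iff.2 hb)
    have hS' : ((Real.sinh a * Real.sinh b : ℝ) : ℂ) ≠ 0 := by exact_mod_cast hS.ne'
    have hv1 : v1 σ p (ww a b 1) = 0 := by
      rcases div_eq_zero_iff.1 hd with h | h
      · exact (mul_eq_zero.1 h).resolve_left hS'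
      · norm_num at h
    rw [ww_one] at hz hv1
    unfold vv at hz
    unfold v1 at hv1
    rw [Real.arcosh_cosh (by linarith)] at hz hv1
    have hs2 : (Real.sqrt (Real.cosh (a + b) ^ 2 - 1) : ℂ) ≠ 0 := by
      have := Real.sqrt_pos.2 (sq_sub_pos (Real.one_lt_cosh.2 (show a + b ≠ 0 by linarith)))
      exact_mod_cast this.ne'
    have hz1 := (div_eq_zero_iff.1 hv1).resolve_right hs2
    have hall := uu_unique σ p (a + b) (by linarith) hz hz1
    have hU : U0 σ p a b = 0 := by
      unfold U0
      rw [setIntegral_congr_fun (g := fun _ => (0:ℂ)) measurableSet_Ioi]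
      · simp
      · intro t ht
        have ht' : (1:ℝ) < t := ht
        change uu σ p 0 (Real.arcosh (ww a b t)) * _ = 0
        rw [hall _ (Real.arcosh_pos (ww_gt_one a b t ha hb ht'.le)), zero_mul]
    rw [hU, hall a ha]
    simp


lemma cpow_pos_exp (x : ℝ) (hx : 0 < x) (s : ℂ) : (x : ℂ) ^ s = Complex.exp (Real.log x * s) := by
  rw [Complex.cpow_def_of_ne_zero (by exact_mod_cast hx.ne'), Complex.ofReal_log hx.le]

/-- The prefactor of the Gegenbauer function. -/
noncomputable def kap (lam α : ℂ) : ℂ :=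
  (Real.sqrt Real.pi : ℂ) * Complex.Gamma (lam + 2 * α) /
      ((2 : ℂ) ^ (2 * α - 1) * Complex.Gamma α * Complex.Gamma (lam + 1))

lemma geg_coth (lam α : ℂ) (c : ℝ) (hc : 0 < c) :
    gegenbauerC lam α (Real.cosh c / Real.sinh c) =
      kap lam α * Complex.exp (-(lam * (Real.log 2 + Real.log (Real.sinh c)))) *
        uu (1 - 2 * α - lam) (1 / 2 - α - lam) 0 c := by
  have hs : 0 < Real.sinh c := Real.sinh_pos_iff.2 hc
  have e1 : (((Real.cosh c / Real.sinh c : ℝ) : ℂ) + 1) / 2 = ((Real.exp c / (2 * Real.sinh c) : ℝ) : ℂ) := by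
    rw [← Real.cosh_add_sinh, ← Complex.ofReal_one, ← Complex.ofReal_add,
      show (2:ℂ) = ((2:ℝ):ℂ) by simp, ← Complex.ofReal_div]
    congr 1
    field_simp
  have e2 : (((Real.cosh c / Real.sinh c : ℝ) : ℂ) - 1) / (((Real.cosh c / Real.sinh c : ℝ) : ℂ) + 1) =
      Complex.exp (-2 * c) := by
    have : (Real.cosh c / Real.sinh c - 1) / (Real.cosh c / Real.sinh c + 1) = Real.exp (-2 * c) := by
      have h1 : Real.cosh c / Real.sinh c - 1 = Real.exp (-c) / Real.sinh c := by
        rw [← Real.cosh_sub_sinh]; field_simp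
      have h2 : Real.cosh c / Real.sinh c + 1 = Real.exp c / Real.sinh c := by
        rw [← Real.cosh_add_sinh]; field_simp
      rw [h1, h2, div_div_div_cancel_right₀ hs.ne', ← Real.exp_sub]
      congr 1; ring
    have h := congrArg (fun x : ℝ => (x : ℂ)) this
    simp only [Complex.ofReal_div, Complex.ofReal_sub, Complex.ofReal_add, Complex.ofReal_one,
      Complex.ofReal_exp, Complex.ofReal_mul, Complex.ofReal_neg, Complex.ofReal_ofNat] at h ⊢
    exact h
  have e3 : hyp2F1reg (-lam) (1 / 2 - α - lam) (α + 1 / 2) (Complex.exp (-2 * c)) * Complex.exp (c * lam) =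
      uu (1 - 2 * α - lam) (1 / 2 - α - lam) 0 c := by
    unfold hyp2F1reg uu tmm hcf
    rw [← tsum_mul_right]
    refine tsum_congr fun n => ?_
    rw [pow_zero, mul_one, mul_assoc, ← Complex.exp_nat_mul, ← Complex.exp_add]
    rw [show 2 * (1 / 2 - α - lam) - (1 - 2 * α - lam) = -lam by ring,
      show 1 - (1 - 2 * α - lam) + (1 / 2 - α - lam) = α + 1 / 2 by ring]
    congr 2
    ring
  unfold gegenbauerC
  rw [e1, e2, cpow_pos_exp _ (by positivity), Real.log_div (by positivity) (by positivity),
    Real.log_mul (by norm_num) hs.ne', Real.log_exp, ← e3]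
  rw [show (((c - (Real.log 2 + Real.log (Real.sinh c)) : ℝ) : ℂ) * lam) =
    -(lam * (Real.log 2 + Real.log (Real.sinh c))) + c * lam by push_cast; ring, Complex.exp_add]
  unfold kap
  ring

lemma exists_coth (z : ℝ) (hz : 1 < z) : ∃ a, 0 < a ∧ z = Real.cosh a / Real.sinh a := by
  have hp := sq_sub_pos hz
  have hr := Real.sqrt_pos.2 hp
  have hsq := Real.sq_sqrt hp.le
  set r := Real.sqrt (z ^ 2 - 1)
  refine ⟨Real.arsinh (1 / r), Real.arsinh_pos_iff.2 (by positivity), ?_⟩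
  rw [Real.cosh_arsinh, Real.sinh_arsinh]
  have : 1 + (1 / r) ^ 2 = (z / r) ^ 2 := by
    field_simp; linarith
  rw [this, Real.sqrt_sq (by positivity)]
  field_simp

/-- The substitution `z₃ = w / √(w² - 1)`. -/
noncomputable def phi (a b t : ℝ) : ℝ := ww a b t / Real.sqrt (ww a b t ^ 2 - 1)

lemma ww_gt_cosh (a b t : ℝ) (ha : 0 < a) (hb : 0 < b) (ht : 1 < t) : Real.cosh (a + b) < ww a b t := by
  have h : 0 < Real.sinh a * Real.sinh b := mul_pos (Real.sinh_pos_iff.2 ha) (Real.sinh_pos_iff.2 hb)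
  rw [← ww_one]; unfold ww; nlinarith

lemma zmax_eq (a b : ℝ) (ha : 0 < a) (hb : 0 < b) :
    (Real.cosh a / Real.sinh a * (Real.cosh b / Real.sinh b) + 1) /
      (Real.cosh a / Real.sinh a + Real.cosh b / Real.sinh b) = Real.cosh (a + b) / Real.sinh (a + b) := by
  have h1 := Real.sinh_pos_iff.2 ha
  have h2 := Real.sinh_pos_iff.2 hb
  have h3 := Real.cosh_pos a
  have h4 := Real.cosh_pos b
  rw [Real.cosh_add, Real.sinh_add]
  field_simp
  ring

lemma phi_image (a b : ℝ) (ha : 0 < a) (hb : 0 < b) :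
    phi a b '' (Ioi 1) = Ioo 1 (Real.cosh (a + b) / Real.sinh (a + b)) := by
  have hD := Real.cosh_pos (a + b)
  have hE : 0 < Real.sinh (a + b) := Real.sinh_pos_iff.2 (by linarith)
  have hDE := Real.cosh_sq (a + b)
  have h : 0 < Real.sinh a * Real.sinh b := mul_pos (Real.sinh_pos_iff.2 ha) (Real.sinh_pos_iff.2 hb)
  ext x
  simp only [mem_image, mem_Ioi, mem_Ioo]
  constructor
  · rintro ⟨t, ht, rfl⟩
    have hw := ww_gt_one a b t ha hb ht.le
    have hw2 := ww_gt_cosh a b t ha hb ht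
    have hp := sq_sub_pos hw
    have hr := Real.sqrt_pos.2 hp
    have hsq := Real.sq_sqrt hp.le
    unfold phi
    set r := Real.sqrt (ww a b t ^ 2 - 1)
    set w := ww a b t
    rw [lt_div_iff₀ hr, div_lt_div_iff₀ hr hE]
    constructor
    · nlinarith
    · apply lt_of_pow_lt_pow_left₀ 2 (by positivity)
      rw [mul_pow, mul_pow, hsq]
      nlinarith
  · rintro ⟨h1, h2⟩
    have hp := sq_sub_pos h1
    have hr := Real.sqrt_pos.2 hp
    have hsq := Real.sq_sqrt hp.le
    set r := Real.sqrt (x ^ 2 - 1)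
    rw [lt_div_iff₀ hE] at h2
    have hx0 : 0 < x := by linarith
    have hww : ww a b ((x / r - Real.cosh a * Real.cosh b) / (Real.sinh a * Real.sinh b)) = x / r := by
      unfold ww; field_simp; ring
    refine ⟨(x / r - Real.cosh a * Real.cosh b) / (Real.sinh a * Real.sinh b), ?_, ?_⟩
    · rw [lt_div_iff₀ h]
      have : Real.cosh (a + b) < x / r := by
        rw [lt_div_iff₀ hr]
        apply lt_of_pow_lt_pow_left₀ 2 hx0.le
        rw [mul_pow, hsq]
        have : (x * Real.sinh (a + b)) ^ 2 < Real.cosh (a + b) ^ 2 := by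
          apply pow_lt_pow_left₀ h2 (by positivity) two_ne_zero
        rw [mul_pow] at this
        nlinarith
      rw [Real.cosh_add] at this
      linarith
    · unfold phi
      rw [hww]
      have : (x / r) ^ 2 - 1 = (1 / r) ^ 2 := by field_simp; linarith
      rw [this, Real.sqrt_sq (by positivity)]
      field_simp

lemma phi_inj (a b : ℝ) (ha : 0 < a) (hb : 0 < b) : InjOn (phi a b) (Ioi 1) := by
  intro x hx y hy hxy
  have h : 0 < Real.sinh a * Real.sinh b := mul_pos (Real.sinh_pos_iff.2 ha) (Real.sinh_pos_iff.2 hb)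
  have hw := ww_gt_one a b x ha hb (le_of_lt hx)
  have hw' := ww_gt_one a b y ha hb (le_of_lt hy)
  have hp := sq_sub_pos hw
  have hp' := sq_sub_pos hw'
  have hr := Real.sqrt_pos.2 hp
  have hsq := Real.sq_sqrt hp.le
  have hr' := Real.sqrt_pos.2 hp'
  have hsq' := Real.sq_sqrt hp'.le
  unfold phi at hxy
  rw [div_eq_div_iff hr.ne' hr'.ne'] at hxy
  have h2 := congrArg (fun x => x ^ 2) hxy
  simp only [mul_pow, hsq, hsq'] at h2
  have h3 : ww a b x ^ 2 = ww a b y ^ 2 := by linarith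
  have h4 : ww a b x = ww a b y := by nlinarith
  unfold ww at h4
  have h5 : Real.sinh a * Real.sinh b * x = Real.sinh a * Real.sinh b * y := by linarith
  exact mul_left_cancel₀ h.ne' h5

lemma phi_deriv (a b t : ℝ) (ha : 0 < a) (hb : 0 < b) (ht : 1 < t) :
    HasDerivAt (phi a b) (-(Real.sinh a * Real.sinh b / Real.sqrt (ww a b t ^ 2 - 1) ^ 3)) t := by
  have hw := ww_gt_one a b t ha hb ht.le
  have hp := sq_sub_pos hw
  have hr := Real.sqrt_pos.2 hp
  have hsq := Real.sq_sqrt hp.le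
  have h1 := ww_hasDerivAt_t a b t
  have h2 := ((h1.pow 2).sub_const 1).sqrt hp.ne'
  refine (h1.div h2 hr.ne').congr_deriv ?_
  simp only [Pi.pow_apply]
  set r := Real.sqrt (ww a b t ^ 2 - 1)
  set w := ww a b t
  field_simp
  push_cast
  rw [hsq]
  ring


lemma C_formula (a b t : ℝ) (ha : 0 < a) (hb : 0 < b) (ht : 1 < t) (z₁ z₂ z₃ : ℝ)
    (h1 : z₁ = Real.cosh a / Real.sinh a) (h2 : z₂ = Real.cosh b / Real.sinh b) (h3 : z₃ = phi a b t) :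
    (1 - z₁ ^ 2 * z₂ ^ 2 - z₁ ^ 2 * z₃ ^ 2 - z₂ ^ 2 * z₃ ^ 2
          + 2 * z₁ ^ 2 * z₂ ^ 2 * z₃ ^ 2) /
        (2 * z₁ * z₂ * z₃ * Real.sqrt ((z₁ ^ 2 - 1) * (z₂ ^ 2 - 1) * (z₃ ^ 2 - 1))) - 1 =
      (Real.sinh a ^ 2 * Real.sinh b ^ 2 * (t ^ 2 - 1)) / (2 * Real.cosh a * Real.cosh b * ww a b t) := by
  have hw := ww_gt_one a b t ha hb ht.le
  have hp := sq_sub_pos hw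
  have hr := Real.sqrt_pos.2 hp
  have hsq := Real.sq_sqrt hp.le
  have hA := Real.sinh_pos_iff.2 ha
  have hB := Real.sinh_pos_iff.2 hb
  have hA2 := Real.cosh_sq a
  have hB2 := Real.cosh_sq b
  have hA3 := Real.cosh_pos a
  have hB3 := Real.cosh_pos b
  have hwt : ww a b t = Real.cosh a * Real.cosh b + Real.sinh a * Real.sinh b * t := rfl
  unfold phi at h3
  set r := Real.sqrt (ww a b t ^ 2 - 1)
  set w := ww a b t
  set A := Real.sinh a
  set B := Real.sinh b
  set P := Real.cosh a
  set Q := Real.cosh b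
  have e : (z₁ ^ 2 - 1) * (z₂ ^ 2 - 1) * (z₃ ^ 2 - 1) = (1 / (A * B * r)) ^ 2 := by
    have e1 : z₁ ^ 2 - 1 = (1 / A) ^ 2 := by rw [h1]; field_simp; linarith
    have e2 : z₂ ^ 2 - 1 = (1 / B) ^ 2 := by rw [h2]; field_simp; linarith
    have e3 : z₃ ^ 2 - 1 = (1 / r) ^ 2 := by rw [h3]; field_simp; linarith
    rw [e1, e2, e3]; field_simp
  have hw0 : 0 < w := by linarith
  rw [e, Real.sqrt_sq (by positivity), h1, h2, h3]
  have hnum : (1 - (P / A) ^ 2 * (Q / B) ^ 2 - (P / A) ^ 2 * (w / r) ^ 2 - (Q / B) ^ 2 * (w / r) ^ 2 +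
      2 * (P / A) ^ 2 * (Q / B) ^ 2 * (w / r) ^ 2) = (P ^ 2 + Q ^ 2 + w ^ 2 - 1) / (A * B * r) ^ 2 := by
    field_simp
    have i1 : A ^ 2 = P ^ 2 - 1 := by linarith
    have i2 : B ^ 2 = Q ^ 2 - 1 := by linarith
    simp only [i1, i2, hsq]
    ring
  rw [hnum]
  have hden : 2 * (P / A) * (Q / B) * (w / r) * (1 / (A * B * r)) = (2 * P * Q * w) / (A * B * r) ^ 2 := by
    field_simp
  rw [hden, div_div_div_cancel_right₀ (by positivity), div_sub_one (by positivity)]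
  congr 1
  have : A * B * t = w - P * Q := by rw [hwt]; ring
  have h4 : A ^ 2 * B ^ 2 * (t ^ 2 - 1) = (A * B * t) ^ 2 - A ^ 2 * B ^ 2 := by ring
  rw [h4, this]
  have i1 : A ^ 2 = P ^ 2 - 1 := by linarith
  have i2 : B ^ 2 = Q ^ 2 - 1 := by linarith
  rw [i1, i2]
  ring

/-- The constant produced by the change of variables. -/
noncomputable def mm (lam α : ℂ) (a b : ℝ) : ℂ :=
  Complex.exp (-(lam * Real.log 2) + (Real.log (Real.sinh a) + Real.log (Real.sinh b)) * (1 - 2 * (lam + α + 1 / 2))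
    + (Real.log 2 + Real.log (Real.cosh a) + Real.log (Real.cosh b)) * (lam + α + 1 / 2))

lemma pointwise (lam α : ℂ) (a b t : ℝ) (ha : 0 < a) (hb : 0 < b) (ht : 1 < t) (Cv : ℝ)
    (hC : Cv - 1 = (Real.sinh a ^ 2 * Real.sinh b ^ 2 * (t ^ 2 - 1)) / (2 * Real.cosh a * Real.cosh b * ww a b t)) :
    |(-(Real.sinh a * Real.sinh b / Real.sqrt (ww a b t ^ 2 - 1) ^ 3))| •
      (gegenbauerC lam α (phi a b t) * ((phi a b t ^ 2 - 1 : ℝ) : ℂ) ^ (α / 2 - 5 / 4) *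
        (phi a b t : ℂ) ^ (-(lam + α + 1 / 2)) * ((Cv : ℂ) - 1) ^ (-lam - α - 1 / 2)) =
    (kap lam α * mm lam α a b) * (vv (1 - 2 * α - lam) (1 / 2 - α - lam) (ww a b t) *
      om ((1 / 2 - α - lam) - 1) t) := by
  have hw := ww_gt_one a b t ha hb ht.le
  have hp := sq_sub_pos hw
  have hr := Real.sqrt_pos.2 hp
  have hsq := Real.sq_sqrt hp.le
  have hA := Real.sinh_pos_iff.2 ha
  have hB := Real.sinh_pos_iff.2 hb
  have hA3 := Real.cosh_pos a
  have hB3 := Real.cosh_pos b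
  have htp := sq_sub_pos ht
  have hg := geg_coth lam α _ (Real.arcosh_pos hw)
  rw [Real.cosh_arcosh hw.le, Real.sinh_arcosh hw.le] at hg
  have hCc : ((Cv : ℂ) - 1) = ((Cv - 1 : ℝ) : ℂ) := by push_cast; ring
  rw [hCc, hC, abs_neg, abs_of_pos (by positivity), Complex.real_smul]
  unfold om vv mm
  unfold phi
  rw [hg]
  set r := Real.sqrt (ww a b t ^ 2 - 1)
  set w := ww a b t
  set A := Real.sinh a
  set B := Real.sinh b
  set P := Real.cosh a
  set Q := Real.cosh b
  have hw0 : 0 < w := by linarith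
  have e3 : (w / r) ^ 2 - 1 = 1 / r ^ 2 := by field_simp; linarith
  have e4 : A * B / r ^ 3 = Real.exp (Real.log (A * B / r ^ 3)) := (Real.exp_log (by positivity)).symm
  rw [e3, e4, cpow_pos_exp _ (by positivity), cpow_pos_exp _ (by positivity), cpow_pos_exp _ (by positivity),
    cpow_pos_exp _ htp]
  rw [Real.log_div (by positivity) (by positivity), Real.log_div (by positivity) (by positivity),
    Real.log_div (by positivity) (by positivity), Real.log_div (by positivity) (by positivity),
    Real.log_mul (by positivity) (by positivity), Real.log_mul (by positivity) (by positivity),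
    Real.log_mul (by positivity) (by positivity), Real.log_mul (by positivity) (by positivity),
    Real.log_mul (by positivity) (by positivity), Real.log_mul (by positivity) (by positivity),
    Real.log_pow, Real.log_pow, Real.log_pow, Real.log_pow, Real.log_one, Complex.ofReal_exp]
  set UU := uu (1 - 2 * α - lam) (1 / 2 - α - lam) 0 (Real.arcosh w)
  have key : ∀ (K x1 x2 x3 x4 x5 y1 y2 : ℂ), x1 + x2 + x3 + x4 + x5 = y1 + y2 →
      Complex.exp x1 * (K * Complex.exp x2 * UU * Complex.exp x3 * Complex.exp x4 * Complex.exp x5) =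
      K * Complex.exp y1 * (UU * Complex.exp y2) := by
    intro K x1 x2 x3 x4 x5 y1 y2 h
    have := congrArg Complex.exp h
    simp only [Complex.exp_add] at this
    linear_combination (K * UU) * this
  apply key
  push_cast
  ring

lemma final_const (lam α : ℂ) (a b : ℝ) (ha : 0 < a) (hb : 0 < b) (R u v : ℂ)
    (hR : R = Real.pi * (2:ℂ) ^ (2 * (1 / 2 - α - lam) - 1) * Complex.Gamma (lam + 2 * α) * (u * v)) :
    (kap lam α * Complex.exp (-(lam * (Real.log 2 + Real.log (Real.sinh a)))) * u) *
      (kap lam α * Complex.exp (-(lam * (Real.log 2 + Real.log (Real.sinh b)))) * v) =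
    kap lam α * mm lam α a b * R / ((2 : ℂ) ^ (α - 1 / 2) * (Real.sqrt Real.pi : ℂ) * Complex.Gamma (lam + 1) *
          Complex.Gamma α * ((Real.cosh a / Real.sinh a * (Real.cosh b / Real.sinh b) : ℝ) : ℂ) ^ (lam + α + 1 / 2) *
          (((Real.cosh a / Real.sinh a) ^ 2 - 1 : ℝ) : ℂ) ^ (α / 2 - 1 / 4) *
          (((Real.cosh b / Real.sinh b) ^ 2 - 1 : ℝ) : ℂ) ^ (α / 2 - 1 / 4)) := by
  have hA := Real.sinh_pos_iff.2 ha
  have hB := Real.sinh_pos_iff.2 hb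
  have hA3 := Real.cosh_pos a
  have hB3 := Real.cosh_pos b
  have hA2 := Real.cosh_sq a
  have hB2 := Real.cosh_sq b
  set A := Real.sinh a with hAd
  set B := Real.sinh b with hBd
  set P := Real.cosh a with hPd
  set Q := Real.cosh b with hQd
  have e1 : (P / A) ^ 2 - 1 = 1 / A ^ 2 := by field_simp; linarith
  have e2 : (Q / B) ^ 2 - 1 = 1 / B ^ 2 := by field_simp; linarith
  have hpi : (Real.pi : ℂ) = (Real.sqrt Real.pi : ℂ) * (Real.sqrt Real.pi : ℂ) := by
    rw [← Complex.ofReal_mul, Real.mul_self_sqrt Real.pi_pos.le]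
  have hpi0 : (Real.sqrt Real.pi : ℂ) ≠ 0 := by
    exact_mod_cast (Real.sqrt_pos.2 Real.pi_pos).ne'
  have h2e : ∀ s : ℂ, (2:ℂ) ^ s = Complex.exp (Real.log 2 * s) := fun s => by
    have := cpow_pos_exp 2 (by norm_num) s
    simpa using this
  rw [e1, e2, hR]
  unfold kap mm
  rw [← hAd, ← hBd, ← hPd, ← hQd]
  rw [cpow_pos_exp _ (by positivity), cpow_pos_exp _ (by positivity), cpow_pos_exp _ (by positivity), h2e, h2e, h2e, hpi]
  rw [Real.log_div (by positivity) (by positivity), Real.log_div (by positivity) (by positivity),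
    Real.log_mul (by positivity) (by positivity), Real.log_div (by positivity) (by positivity),
    Real.log_div (by positivity) (by positivity),
    Real.log_pow, Real.log_pow, Real.log_one]
  generalize (Real.sqrt Real.pi : ℂ) = S at hpi0
  generalize Complex.Gamma (lam + 2 * α) = G
  generalize Complex.Gamma (lam + 1) = G1
  generalize Complex.Gamma α = G2
  have key : ∀ (x0 x1 x2 y1 y2 y3 y4 y5 y6 : ℂ), -x0 + x1 + x2 = y1 + y2 - y3 - y4 - y5 - y6 →
      (S * G / (Complex.exp x0 * G2 * G1) * Complex.exp x1 * u) * (S * G / (Complex.exp x0 * G2 * G1) * Complex.exp x2 * v) =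
      S * G / (Complex.exp x0 * G2 * G1) * Complex.exp y1 * (S * S * Complex.exp y2 * G * (u * v)) /
        (Complex.exp y3 * S * G1 * G2 * Complex.exp y4 * Complex.exp y5 * Complex.exp y6) := by
    intro x0 x1 x2 y1 y2 y3 y4 y5 y6 h
    have h' := congrArg Complex.exp h
    simp only [Complex.exp_add, sub_eq_add_neg, Complex.exp_neg] at h'
    simp only [div_eq_mul_inv, mul_inv]
    have hS : S⁻¹ * S = 1 := inv_mul_cancel₀ hpi0
    linear_combination (S * G * (Complex.exp x0)⁻¹ * G2⁻¹ * G1⁻¹ * S * G * G2⁻¹ * G1⁻¹ * u * v) * h' -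
      (S * G * (Complex.exp x0)⁻¹ * G2⁻¹ * G1⁻¹ * Complex.exp y1 * (S * Complex.exp y2 * G * (u * v)) *
        (Complex.exp y3)⁻¹ * G1⁻¹ * G2⁻¹ * (Complex.exp y4)⁻¹ * (Complex.exp y5)⁻¹ * (Complex.exp y6)⁻¹) * hS
  apply key
  push_cast
  ring

theorem gegenbauerCC_kernel_product
    (lam α : ℂ) (h1 : 0 < (lam + 2 * α).re) (h2 : ∀ n : ℕ, lam + α + 1 / 2 ≠ -(n : ℂ))
    (z₁ z₂ : ℝ) (hz₁ : 1 < z₁) (hz₂ : 1 < z₂)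
    (C : ℝ → ℝ)
    (hC : ∀ z₃, C z₃ = (1 - z₁ ^ 2 * z₂ ^ 2 - z₁ ^ 2 * z₃ ^ 2 - z₂ ^ 2 * z₃ ^ 2
          + 2 * z₁ ^ 2 * z₂ ^ 2 * z₃ ^ 2) /
        (2 * z₁ * z₂ * z₃ * Real.sqrt ((z₁ ^ 2 - 1) * (z₂ ^ 2 - 1) * (z₃ ^ 2 - 1))))
    (F : ℝ → ℂ)
    (hF : ∀ z₃, F z₃ = gegenbauerC lam α z₃ * ((z₃ ^ 2 - 1 : ℝ) : ℂ) ^ (α / 2 - 5 / 4) *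
        (z₃ : ℂ) ^ (-(lam + α + 1 / 2)) * ((C z₃ : ℂ) - 1) ^ (-lam - α - 1 / 2))
    (hint : IntegrableOn F (Ioo 1 ((z₁ * z₂ + 1) / (z₁ + z₂)))) :
    gegenbauerC lam α z₁ * gegenbauerC lam α z₂ =
      Complex.cos ((Real.pi : ℂ) * (lam + α)) * Complex.Gamma (lam + α + 1 / 2) /
        ((2 : ℂ) ^ (α - 1 / 2) * (Real.sqrt Real.pi : ℂ) * Complex.Gamma (lam + 1) *
          Complex.Gamma α * ((z₁ * z₂ : ℝ) : ℂ) ^ (lam + α + 1 / 2) *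
          ((z₁ ^ 2 - 1 : ℝ) : ℂ) ^ (α / 2 - 1 / 4) * ((z₂ ^ 2 - 1 : ℝ) : ℂ) ^ (α / 2 - 1 / 4)) *
        ∫ z₃ in Ioo 1 ((z₁ * z₂ + 1) / (z₁ + z₂)), F z₃ := by
  obtain ⟨a, ha, ea⟩ := exists_coth z₁ hz₁
  obtain ⟨b, hb, eb⟩ := exists_coth z₂ hz₂
  set p : ℂ := 1 / 2 - α - lam with hp
  set σ : ℂ := 1 - 2 * α - lam with hσ
  have hpt : ∀ t ∈ Ioi (1:ℝ), |(-(Real.sinh a * Real.sinh b / Real.sqrt (ww a b t ^ 2 - 1) ^ 3))| • F (phi a b t) =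
      (kap lam α * mm lam α a b) * (vv σ p (ww a b t) * om (p - 1) t) := by
    intro t ht
    rw [hF]
    exact pointwise lam α a b t ha hb ht _ (by rw [hC]; exact C_formula a b t ha hb ht z₁ z₂ _ ea eb rfl)
  have hder : ∀ t ∈ Ioi (1:ℝ), HasDerivWithinAt (phi a b)
      (-(Real.sinh a * Real.sinh b / Real.sqrt (ww a b t ^ 2 - 1) ^ 3)) (Ioi 1) t :=
    fun t ht => (phi_deriv a b t ha hb ht).hasDerivWithinAt
  have hI := integral_image_eq_integral_abs_deriv_smul (s := Ioi (1:ℝ)) measurableSet_Ioi hder (phi_inj a b ha hb) F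
  have hii := integrableOn_image_iff_integrableOn_abs_deriv_smul (s := Ioi (1:ℝ)) measurableSet_Ioi hder (phi_inj a b ha hb) F
  have hz : (z₁ * z₂ + 1) / (z₁ + z₂) = Real.cosh (a + b) / Real.sinh (a + b) := by
    rw [ea, eb]; exact zmax_eq a b ha hb
  rw [phi_image a b ha hb, ← hz] at hI hii
  have hint2 := (hii.1 hint).congr_fun hpt measurableSet_Ioi
  rw [setIntegral_congr_fun measurableSet_Ioi hpt, integral_const_mul] at hI
  change _ = kap lam α * mm lam α a b * U0 σ p a b at hI
  rw [hI]
  have g1 := geg_coth lam α a ha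
  have g2 := geg_coth lam α b hb
  rw [← ea] at g1
  rw [← eb] at g2
  rw [g1, g2]
  by_cases hk : kap lam α = 0
  · rw [hk]; simp
  have hm0 : kap lam α * mm lam α a b ≠ 0 := mul_ne_zero hk (Complex.exp_ne_zero _)
  have hint3 : IntegrableOn (fun t => vv σ p (ww a b t) * om (p - 1) t) (Ioi 1) := by
    have h := Integrable.const_mul hint2 (kap lam α * mm lam α a b)⁻¹
    refine h.congr (Filter.Eventually.of_forall fun t => ?_)
    change (kap lam α * mm lam α a b)⁻¹ * ((kap lam α * mm lam α a b) * _) = _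
    rw [inv_mul_cancel_left₀ hm0]
  have hs : 1 - p = lam + α + 1 / 2 := by rw [hp]; ring
  have hcore := core σ p (by rw [hσ]; simp at h1 ⊢; linarith) (fun n => by rw [hs]; exact h2 n) a b ha hb hint3
  have hcos : Complex.sin (Real.pi * p) = Complex.cos ((Real.pi : ℂ) * (lam + α)) := by
    rw [← Complex.sin_pi_div_two_sub]
    congr 1
    rw [hp]; ring
  have hs2 : 1 - σ = lam + 2 * α := by rw [hσ]; ring
  rw [hs, hcos, hs2] at hcore
  have hfin := final_const lam α a b ha hb _ _ _ hcore
  rw [← ea, ← eb] at hfin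
  rw [hfin]
  ring
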